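/- arXiv:math/0310065 — 2 statements merged into one kernel-verified Lean document; each statement's English description precedes it below -/
import Mathlib

section
/- Let B be a finitely generated group with a (K,C)-quasi-action A on a simplicial tree T, and let b ∈ B quasi-act hyperbolically, i.e. for some x ∈ T the map n ↦ A(bⁿ, x) is a quasi-isometric embedding of ℤ into T. Then either B contains a subgroup isomorphic to the free group on two generators, or there exist a subgroup H ≤ B of index at most 2 with b ∈ H and a pseudocharacter p : H → ℝ with p(b) ≠ 0. -/
/-- A pseudocharacter on a group: bounded defect and homogeneity on cyclic subgroups. -/
def IsPseudocharacter {G : Type*} [Group G] (f : G → ℝ) : Prop :=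
  (∃ D : ℝ, ∀ g h : G, |f (g * h) - f g - f h| ≤ D) ∧
  ∀ (g : G) (n : ℤ), f (g ^ n) = (n : ℝ) * f g

open Filter Topology Pointwise

/-! ### Homogenization of quasimorphisms -/

/-- A quasimorphism is within bounded distance of a pseudocharacter. -/
theorem exists_isPseudocharacter_of_quasimorphism {G : Type*} [Group G] (f : G → ℝ) (D : ℝ)
    (hf : ∀ g h : G, |f (g * h) - f g - f h| ≤ D) :
    ∃ p : G → ℝ, IsPseudocharacter p ∧ ∀ g, |p g - f g| ≤ D := by
  have hcauchy : ∀ g : G, ∀ n : ℕ, dist (f (g ^ 2 ^ n) / 2 ^ n) (f (g ^ 2 ^ (n + 1)) / 2 ^ (n + 1))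
      ≤ D / 2 / 2 ^ n := by
    intro g n
    have h := hf (g ^ 2 ^ n) (g ^ 2 ^ n)
    rw [← pow_add, ← two_mul, ← pow_succ'] at h
    have h2 : (0 : ℝ) < 2 ^ n := by positivity
    rw [dist_comm, Real.dist_eq]
    have : f (g ^ 2 ^ (n + 1)) / 2 ^ (n + 1) - f (g ^ 2 ^ n) / 2 ^ n
        = (f (g ^ 2 ^ (n + 1)) - f (g ^ 2 ^ n) - f (g ^ 2 ^ n)) / 2 / 2 ^ n := by
      field_simp
      ring
    rw [this, abs_div, abs_div, abs_of_pos h2, abs_two]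
    gcongr
  choose p hp using fun g =>
    cauchySeq_tendsto_of_complete (cauchySeq_of_le_geometric_two (hcauchy g))
  have hpf : ∀ g, |p g - f g| ≤ D := fun g => by
    have := dist_le_of_le_geometric_two_of_tendsto₀ (hcauchy g) (hp g)
    rwa [dist_comm, Real.dist_eq, pow_zero, pow_zero, pow_one, div_one] at this
  have hquasi : ∀ g h : G, |p (g * h) - p g - p h| ≤ 4 * D := fun g h => by
    have h1 := abs_le.1 (hf g h)
    have h2 := abs_le.1 (hpf g)
    have h3 := abs_le.1 (hpf h)
    have h4 := abs_le.1 (hpf (g * h))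
    rw [abs_le]
    constructor <;> linarith
  have hpow : ∀ (g : G) (k : ℕ), p (g ^ 2 ^ k) = 2 ^ k * p g := fun g k => by
    have h1 := ((tendsto_add_atTop_iff_nat k).2 (hp g)).const_mul (2 ^ k)
    refine tendsto_nhds_unique (hp (g ^ 2 ^ k)) (h1.congr fun n => ?_)
    rw [← pow_mul, ← pow_add, add_comm k n, pow_add (2 : ℝ)]
    field_simp
  have hbdd : ∀ n : ℤ, ∃ E : ℝ, ∀ g : G, |p (g ^ n) - n * p g| ≤ E := by
    intro n
    induction n using Int.induction_on with
    | zero => exact ⟨|p 1|, fun g => by simp⟩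
    | succ n ih =>
      obtain ⟨E, hE⟩ := ih
      refine ⟨E + 4 * D, fun g => ?_⟩
      have h1 := abs_le.1 (hE g)
      have h2 := abs_le.1 (hquasi (g ^ (n : ℤ)) g)
      rw [← zpow_add_one] at h2
      rw [abs_le]
      push_cast at *
      constructor <;> linarith
    | pred n ih =>
      obtain ⟨E, hE⟩ := ih
      refine ⟨E + 4 * D, fun g => ?_⟩
      have h1 := abs_le.1 (hE g)
      have h2 := abs_le.1 (hquasi (g ^ (-(n : ℤ) - 1)) g)
      rw [← zpow_add_one, sub_add_cancel] at h2
      rw [abs_le]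
      push_cast at *
      constructor <;> linarith
  refine ⟨p, ⟨⟨4 * D, hquasi⟩, fun g n => ?_⟩, hpf⟩
  obtain ⟨E, hE⟩ := hbdd n
  by_contra hne
  have hpos : 0 < |p (g ^ n) - n * p g| := abs_pos.2 (sub_ne_zero.2 hne)
  obtain ⟨k, hk⟩ := pow_unbounded_of_one_lt (E / |p (g ^ n) - n * p g|) (one_lt_two (α := ℝ))
  rw [div_lt_iff₀ hpos] at hk
  have h := hE (g ^ 2 ^ k)
  rw [← zpow_natCast, ← zpow_mul, mul_comm _ n, zpow_mul, zpow_natCast, zpow_natCast, hpow, hpow,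
    show (2 : ℝ) ^ k * p (g ^ n) - n * (2 ^ k * p g) = 2 ^ k * (p (g ^ n) - n * p g) by ring,
    abs_mul, abs_of_pos (by positivity : (0 : ℝ) < 2 ^ k)] at h
  linarith

/-! ### Hyperbolic pseudometrics -/

/-- The Gromov product of `x` and `y` based at `o`. -/
noncomputable def gromovProd {α : Type*} (d : α → α → ℝ) (o x y : α) : ℝ :=
  (d o x + d o y - d x y) / 2

/-- A pseudometric satisfying the Gromov four point condition with constant `δ`. -/
structure IsHypDist {α : Type*} (δ : ℝ) (d : α → α → ℝ) : Prop where
  self : ∀ x, d x x = 0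
  symm : ∀ x y, d x y = d y x
  triangle : ∀ x y z, d x z ≤ d x y + d y z
  hyp : ∀ o x y z, min (gromovProd d o x y) (gromovProd d o y z) - δ ≤ gromovProd d o x z

namespace IsHypDist

variable {α : Type*} {δ : ℝ} {d : α → α → ℝ}

theorem comap {β : Type*} (hd : IsHypDist δ d) (f : β → α) :
    IsHypDist δ fun x y => d (f x) (f y) where
  self _ := hd.self _
  symm _ _ := hd.symm _ _
  triangle _ _ _ := hd.triangle _ _ _
  hyp _ _ _ _ := hd.hyp _ _ _ _

theorem nonneg (hd : IsHypDist δ d) (x y : α) : 0 ≤ d x y := by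
  have h1 := hd.triangle x y x
  rw [hd.self, hd.symm y x] at h1
  linarith

theorem gromovProd_comm (hd : IsHypDist δ d) (o x y : α) :
    gromovProd d o x y = gromovProd d o y x := by
  simp only [gromovProd, hd.symm x y]
  ring

theorem gromovProd_nonneg (hd : IsHypDist δ d) (o x y : α) : 0 ≤ gromovProd d o x y := by
  have := hd.triangle x o y
  rw [hd.symm x o] at this
  simp only [gromovProd]
  linarith

theorem gromovProd_le_left (hd : IsHypDist δ d) (o x y : α) : gromovProd d o x y ≤ d o x := by
  have := hd.triangle o x y
  simp only [gromovProd]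
  linarith

theorem gromovProd_le_right (hd : IsHypDist δ d) (o x y : α) : gromovProd d o x y ≤ d o y := by
  rw [hd.gromovProd_comm]
  exact hd.gromovProd_le_left o y x

theorem gromovProd_le_base (hd : IsHypDist δ d) (o o' x y : α) :
    gromovProd d o x y ≤ d o o' + gromovProd d o' x y := by
  have h1 := hd.triangle o o' x
  have h2 := hd.triangle o o' y
  simp only [gromovProd]
  linarith

theorem gromovProd_le_add_left (hd : IsHypDist δ d) (o x x' y : α) :
    gromovProd d o x y ≤ gromovProd d o x' y + d x x' := by
  have h1 := hd.triangle o x' x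
  have h2 := hd.triangle x' x y
  rw [hd.symm x' x] at h1 h2
  simp only [gromovProd]
  linarith

theorem gromovProd_le_add_right (hd : IsHypDist δ d) (o x y y' : α) :
    gromovProd d o x y ≤ gromovProd d o x y' + d y y' := by
  rw [hd.gromovProd_comm o x y, hd.gromovProd_comm o x y']
  exact hd.gromovProd_le_add_left o y y' x

theorem sub_le_gromovProd (hd : IsHypDist δ d) (o x y : α) :
    d o x - d x y ≤ gromovProd d o x y := by
  have := hd.triangle o y x
  rw [hd.symm y x] at this
  simp only [gromovProd]
  linarith

theorem lt_gromovProd (hd : IsHypDist δ d) {o x y z : α} {t : ℝ} (h : t < gromovProd d o x y)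
    (h' : t < gromovProd d o y z) : t - δ < gromovProd d o x z := by
  have h1 := hd.hyp o x y z
  have h2 := lt_min h h'
  linarith

/-- Busemann-type cocycles depend on the far point only up to `2 * δ`. -/
theorem abs_cocycle_sub_le (hd : IsHypDist δ d) {o h y z : α}
    (hyz : d o h + δ < gromovProd d o y z) :
    |(d h y - d o y) - (d h z - d o z)| ≤ 2 * δ := by
  have h1 := hd.hyp o h y z
  have h2 := hd.hyp o h z y
  have h3 := hd.gromovProd_le_left o h y
  have h4 := hd.gromovProd_le_left o h z
  have h5 := hd.gromovProd_comm o y z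
  have h6 : gromovProd d o h y - δ ≤ gromovProd d o h z := by
    rcases min_choice (gromovProd d o h y) (gromovProd d o y z) with h | h <;> rw [h] at h1 <;>
      linarith
  have h7 : gromovProd d o h z - δ ≤ gromovProd d o h y := by
    rcases min_choice (gromovProd d o h z) (gromovProd d o z y) with h | h <;> rw [h] at h2 <;>
      linarith
  simp only [gromovProd] at h6 h7
  rw [abs_le]
  constructor <;> linarith

end IsHypDist

/-! ### Ends of a group with an invariant hyperbolic pseudometric -/

/-- Two sequences converge to the same point of the Gromov boundary. -/
def Asymptotic {B : Type*} [Group B] (D : B → B → ℝ) (u v : ℕ → B) : Prop :=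
  ∀ R : ℝ, ∃ N : ℕ, ∀ m ≥ N, ∀ n ≥ N, R ≤ gromovProd D 1 (u m) (v n)

/-- The boundary point determined by a sequence, as the set of all sequences converging to it. -/
def endOf {B : Type*} [Group B] (D : B → B → ℝ) (u : ℕ → B) : Set (ℕ → B) :=
  {v | Asymptotic D u v}

/-- The attracting boundary point of `b`. -/
def endPow {B : Type*} [Group B] (D : B → B → ℝ) (b : B) : Set (ℕ → B) :=
  endOf D (fun n => b ^ n)

/-- The orbit of `b` is coarsely a geodesic ray escaping to infinity. -/
structure IsLoxodromic {B : Type*} [Group B] (D : B → B → ℝ) (M : ℝ) (b : B) : Prop where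
  add_le : ∀ m n : ℕ, D 1 (b ^ m) + D 1 (b ^ n) - 2 * M ≤ D 1 (b ^ (m + n))
  tendsto : Tendsto (fun n : ℕ => D 1 (b ^ n)) atTop atTop

section Ends

variable {B : Type*} [Group B] {D : B → B → ℝ} {δ M : ℝ} {u v w : ℕ → B} {b : B}

theorem gromovProd_mul_mul (hinv : ∀ k g h, D (k * g) (k * h) = D g h) (k o x y : B) :
    gromovProd D (k * o) (k * x) (k * y) = gromovProd D o x y := by
  simp only [gromovProd, hinv]

theorem gromovProd_one_mul_mul (hinv : ∀ k g h, D (k * g) (k * h) = D g h) (k x y : B) :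
    gromovProd D 1 (k * x) (k * y) = gromovProd D k⁻¹ x y := by
  rw [← gromovProd_mul_mul hinv k k⁻¹, mul_inv_cancel]

theorem gromovProd_mul_left_self (hD : IsHypDist δ D) (hinv : ∀ k g h, D (k * g) (k * h) = D g h)
    (k x : B) : gromovProd D 1 (k * x) k = D 1 k - gromovProd D 1 x k⁻¹ := by
  have h1 := hinv k x 1
  have h2 := hinv k 1 k⁻¹
  have h3 := hinv k x k⁻¹
  rw [mul_one] at h1 h2
  rw [mul_inv_cancel] at h2 h3
  simp only [gromovProd]
  rw [h1, ← h3, ← h2, hD.symm k 1, hD.symm (k * x) 1, hD.symm x 1]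
  ring

theorem Asymptotic.symm (hD : IsHypDist δ D) (h : Asymptotic D u v) : Asymptotic D v u := by
  intro R
  obtain ⟨N, hN⟩ := h R
  exact ⟨N, fun m hm n hn => (hN n hn m hm).trans_eq (hD.gromovProd_comm _ _ _)⟩

theorem Asymptotic.trans (hD : IsHypDist δ D) (h : Asymptotic D u v) (h' : Asymptotic D v w) :
    Asymptotic D u w := by
  intro R
  obtain ⟨N, hN⟩ := h (R + δ)
  obtain ⟨N', hN'⟩ := h' (R + δ)
  refine ⟨max N N', fun m hm n hn => ?_⟩
  have h1 := hN m (le_of_max_le_left hm) (max N N') (le_max_left _ _)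
  have h2 := hN' (max N N') (le_max_right _ _) n (le_of_max_le_right hn)
  have h3 := hD.hyp 1 (u m) (v (max N N')) (w n)
  have := le_min h1 h2
  linarith

theorem Asymptotic.smul (hD : IsHypDist δ D) (hinv : ∀ k g h, D (k * g) (k * h) = D g h)
    (g : B) (h : Asymptotic D u v) : Asymptotic D (g • u) (g • v) := by
  intro R
  obtain ⟨N, hN⟩ := h (R + D 1 g⁻¹)
  refine ⟨N, fun m hm n hn => ?_⟩
  have h1 := hN m hm n hn
  have h2 := hD.gromovProd_le_base 1 g⁻¹ (u m) (v n)
  simp only [Pi.smul_apply, smul_eq_mul, gromovProd_one_mul_mul hinv]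
  linarith

theorem endOf_eq_endOf_iff (hD : IsHypDist δ D) (hv : Asymptotic D v v) :
    endOf D u = endOf D v ↔ Asymptotic D u v := by
  constructor
  · intro h
    have : v ∈ endOf D v := hv
    rwa [← h] at this
  · intro h
    ext w
    exact ⟨fun hw => (h.symm hD).trans hD hw, fun hw => h.trans hD hw⟩

theorem smul_endOf (hD : IsHypDist δ D) (hinv : ∀ k g h, D (k * g) (k * h) = D g h)
    (g : B) : g • endOf D u = endOf D (g • u) := by
  ext w
  rw [Set.mem_smul_set_iff_inv_smul_mem]
  constructor
  · intro h
    have := Asymptotic.smul hD hinv g h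
    rwa [smul_inv_smul] at this
  · intro h
    have := Asymptotic.smul hD hinv g⁻¹ h
    rwa [inv_smul_smul] at this

theorem exists_gromovProd_le_of_not_asymptotic (hD : IsHypDist δ D) (hu : Asymptotic D u u)
    (hv : Asymptotic D v v) (h : ¬ Asymptotic D u v) :
    ∃ R : ℝ, ∃ N : ℕ, ∀ m ≥ N, ∀ n ≥ N, gromovProd D 1 (u m) (v n) ≤ R := by
  simp only [Asymptotic, not_forall, not_exists, not_le] at h
  obtain ⟨R, hR⟩ := h
  obtain ⟨N₁, hN₁⟩ := hu (R + 2 * δ + 1)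
  obtain ⟨N₂, hN₂⟩ := hv (R + 2 * δ + 1)
  obtain ⟨N₃, hN₃⟩ := hu (R + δ + 1)
  obtain ⟨m₀, hm₀, n₀, hn₀, hlt⟩ := hR (max (max N₁ N₂) N₃)
  refine ⟨R + 2 * δ, max (max N₁ N₂) N₃, fun m hm n hn => ?_⟩
  simp only [ge_iff_le, max_le_iff] at hm hn hm₀ hn₀
  by_contra! hcon
  have h3 := hN₂ n hn.1.2 n₀ hn₀.1.2
  have h4 := hN₃ m₀ hm₀.2 m hm.2
  have h5 := hD.lt_gromovProd hcon
    (show R + 2 * δ < gromovProd D 1 (v n) (v n₀) by linarith)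
  have h6 := hD.lt_gromovProd (show R + δ < gromovProd D 1 (u m₀) (u m) by linarith)
    (show R + δ < gromovProd D 1 (u m) (v n₀) by linarith)
  linarith

/-! ### Loxodromic elements -/

theorem dist_one_inv (hD : IsHypDist δ D) (hinv : ∀ k g h, D (k * g) (k * h) = D g h) (g : B) :
    D 1 g⁻¹ = D 1 g := by
  rw [← hinv g 1 g⁻¹, mul_one, mul_inv_cancel, hD.symm]

namespace IsLoxodromic

theorem inv (hb : IsLoxodromic D M b) (hD : IsHypDist δ D)
    (hinv : ∀ k g h, D (k * g) (k * h) = D g h) : IsLoxodromic D M b⁻¹ where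
  add_le m n := by
    simpa only [inv_pow, dist_one_inv hD hinv] using hb.add_le m n
  tendsto := by
    simpa only [inv_pow, dist_one_inv hD hinv] using hb.tendsto

theorem asymptotic_pow (hb : IsLoxodromic D M b) (hD : IsHypDist δ D)
    (hinv : ∀ k g h, D (k * g) (k * h) = D g h) :
    Asymptotic D (fun n => b ^ n) (fun n => b ^ n) := by
  intro R
  obtain ⟨N, hN⟩ := eventually_atTop.1 (hb.tendsto.eventually_ge_atTop (R + M))
  have key : ∀ m n : ℕ, R + M ≤ D 1 (b ^ m) → R ≤ gromovProd D 1 (b ^ m) (b ^ (m + n)) := by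
    intro m n hm
    have h1 := hb.add_le m n
    have h2 := hinv (b ^ m) 1 (b ^ n)
    rw [mul_one, ← pow_add] at h2
    simp only [gromovProd]
    linarith
  refine ⟨N, fun m hm n hn => ?_⟩
  rcases le_total m n with h | h <;> obtain ⟨k, rfl⟩ := Nat.exists_eq_add_of_le h
  · exact key m k (hN m hm)
  · rw [hD.gromovProd_comm]
    exact key n k (hN n hn)

theorem gromovProd_pow_inv_pow_le (hb : IsLoxodromic D M b) (hD : IsHypDist δ D)
    (hinv : ∀ k g h, D (k * g) (k * h) = D g h) (m n : ℕ) :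
    gromovProd D 1 (b ^ m) (b⁻¹ ^ n) ≤ M := by
  have h1 := hb.add_le m n
  have h2 := hinv (b ^ n) (b ^ m) (b⁻¹ ^ n)
  rw [inv_pow, mul_inv_cancel, ← pow_add, add_comm, hD.symm] at h2
  rw [inv_pow, gromovProd, dist_one_inv hD hinv]
  linarith

theorem smul_endPow_self (hb : IsLoxodromic D M b) (hD : IsHypDist δ D)
    (hinv : ∀ k g h, D (k * g) (k * h) = D g h) : b • endPow D b = endPow D b := by
  have h := hb.asymptotic_pow hD hinv
  rw [endPow, smul_endOf hD hinv, endOf_eq_endOf_iff hD h]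
  intro R
  obtain ⟨N, hN⟩ := h R
  refine ⟨N, fun m hm n hn => ?_⟩
  have := hN (m + 1) (by omega) n hn
  simp only [pow_succ'] at this
  exact this

theorem smul_endPow_inv (hb : IsLoxodromic D M b) (hD : IsHypDist δ D)
    (hinv : ∀ k g h, D (k * g) (k * h) = D g h) : b • endPow D b⁻¹ = endPow D b⁻¹ := by
  rw [← eq_inv_smul_iff]
  exact ((hb.inv hD hinv).smul_endPow_self hD hinv).symm

theorem endPow_ne_endPow_inv (hb : IsLoxodromic D M b) (hD : IsHypDist δ D)
    (hinv : ∀ k g h, D (k * g) (k * h) = D g h) : endPow D b ≠ endPow D b⁻¹ := by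
  intro h
  rw [endPow, endPow, endOf_eq_endOf_iff hD ((hb.inv hD hinv).asymptotic_pow hD hinv)] at h
  obtain ⟨N, hN⟩ := h (M + 1)
  have h1 := hN N le_rfl N le_rfl
  have h2 := hb.gromovProd_pow_inv_pow_le hD hinv N N
  linarith

/-- A loxodromic element fixes no boundary point besides its two limit points. -/
theorem endOf_eq_of_smul_eq (hb : IsLoxodromic D M b) (hD : IsHypDist δ D)
    (hinv : ∀ k g h, D (k * g) (k * h) = D g h) (hu : Asymptotic D u u)
    (hfix : b • endOf D u = endOf D u) :
    endOf D u = endPow D b ∨ endOf D u = endPow D b⁻¹ := by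
  by_contra! hne
  have hb' := hb.inv hD hinv
  have hasy := hb.asymptotic_pow hD hinv
  have hasy' := hb'.asymptotic_pow hD hinv
  simp only [endPow, ne_eq, endOf_eq_endOf_iff hD hasy, endOf_eq_endOf_iff hD hasy'] at hne
  obtain ⟨R₁, N₁, h₁⟩ := exists_gromovProd_le_of_not_asymptotic hD hu hasy hne.1
  obtain ⟨R₂, N₂, h₂⟩ := exists_gromovProd_le_of_not_asymptotic hD hu hasy' hne.2
  obtain ⟨k, hk, hkN⟩ := ((hb.tendsto.eventually_gt_atTop (R₁ + R₂ + δ)).and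
    (eventually_ge_atTop (max N₁ N₂))).exists
  have hfixk : b ^ k • endOf D u = endOf D u := by
    have : b ∈ MulAction.stabilizer B (endOf D u) := hfix
    exact pow_mem this k
  rw [smul_endOf hD hinv, endOf_eq_endOf_iff hD hu] at hfixk
  obtain ⟨N₃, h₃⟩ := hfixk (R₁ + δ + 1)
  set n := max (max N₁ N₂) N₃
  have e1 := h₃ n (le_max_right _ _) n (le_max_right _ _)
  have e2 := h₁ n (by simp [n]) k (le_of_max_le_left hkN)
  have e3 := h₂ n (by simp [n]) k (le_of_max_le_right hkN)
  have e4 := gromovProd_mul_left_self hD hinv (b ^ k) (u n)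
  simp only [Pi.smul_apply, smul_eq_mul, inv_pow] at e1 e3
  rw [hD.gromovProd_comm] at e1
  have e5 := hD.lt_gromovProd (show R₁ + δ < gromovProd D 1 (u n) (b ^ k * u n) by linarith)
    (show R₁ + δ < gromovProd D 1 (b ^ k * u n) (b ^ k) by linarith)
  linarith

/-- A subgroup fixing the attracting point of `b` carries a Busemann pseudocharacter. -/
theorem exists_isPseudocharacter (hb : IsLoxodromic D M b) (hD : IsHypDist δ D)
    (hinv : ∀ k g h, D (k * g) (k * h) = D g h) (H : Subgroup B) (hbH : b ∈ H)
    (hH : ∀ g ∈ H, g • endPow D b = endPow D b) :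
    ∃ p : H → ℝ, IsPseudocharacter p ∧ p ⟨b, hbH⟩ ≠ 0 := by
  have hasy := hb.asymptotic_pow hD hinv
  have hlim : ∀ g : H, ∃ r : ℝ, ∃ N : ℕ, ∀ n ≥ N,
      |D g (b ^ n) - D 1 (b ^ n) - r| ≤ 2 * δ := by
    intro g
    obtain ⟨N, hN⟩ := hasy (D 1 g + δ + 1)
    refine ⟨D g (b ^ N) - D 1 (b ^ N), N, fun n hn => hD.abs_cocycle_sub_le ?_⟩
    linarith [hN n hn N le_rfl]
  choose β N hβ using hlim
  have hquasi : ∀ g h : H, |β (g * h) - β g - β h| ≤ 8 * δ := by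
    intro g h
    have hfix := hH g⁻¹ (inv_mem g.2)
    rw [endPow, smul_endOf hD hinv, endOf_eq_endOf_iff hD hasy] at hfix
    obtain ⟨N', hN'⟩ := hfix (D 1 h + δ + 1)
    set n := max (max (N (g * h)) (N g)) (max (N h) N')
    have h1 := abs_le.1 (hβ (g * h) n (by simp [n]))
    have h2 := abs_le.1 (hβ g n (by simp [n]))
    have h3 := abs_le.1 (hβ h n (by simp [n]))
    have h4 := hN' n (by simp [n]) n (by simp [n])
    simp only [Pi.smul_apply, smul_eq_mul] at h4
    have h5 := abs_le.1 (hD.abs_cocycle_sub_le (show D 1 (h : B) + δ < _ by linarith))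
    have e1 := hinv g h ((g : B)⁻¹ * b ^ n)
    have e2 := hinv g 1 ((g : B)⁻¹ * b ^ n)
    rw [mul_inv_cancel_left] at e1 e2
    rw [mul_one] at e2
    rw [Subgroup.coe_mul] at h1
    rw [abs_le]
    constructor <;> linarith
  obtain ⟨p, hp, hpβ⟩ := exists_isPseudocharacter_of_quasimorphism β _ hquasi
  refine ⟨p, hp, fun h0 => ?_⟩
  obtain ⟨k, hk⟩ := (hb.tendsto.eventually_gt_atTop (2 * M + 2 * δ + 8 * δ)).exists
  have h1 := hp.2 ⟨b, hbH⟩ k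
  rw [h0, mul_zero] at h1
  have h2 := hpβ (⟨b, hbH⟩ ^ (k : ℤ))
  have h3 := hβ (⟨b, hbH⟩ ^ (k : ℤ)) (k + N (⟨b, hbH⟩ ^ (k : ℤ))) (by omega)
  rw [h1] at h2
  generalize N (⟨b, hbH⟩ ^ (k : ℤ)) = n at h3
  simp only [zpow_natCast, Subgroup.coe_pow] at h2 h3
  have h4 := hinv (b ^ k) 1 (b ^ n)
  rw [mul_one, ← pow_add] at h4
  rw [h4] at h3
  have h5 := hb.add_le k n
  have h6 := abs_le.1 h2
  have h7 := abs_le.1 h3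
  linarith

end IsLoxodromic

end Ends

/-! ### Ping-pong -/

theorem injective_lift_of_gromovProd_lt {ι B : Type} [Nontrivial ι] [Group B] {D : B → B → ℝ}
    {δ R : ℝ} (hD : IsHypDist δ D) (hinv : ∀ k g h, D (k * g) (k * h) = D g h) (a : ι → B)
    (hR : 0 ≤ R) (hlong : ∀ i, 2 * R ≤ D 1 (a i))
    (hself : ∀ i, gromovProd D 1 (a i) (a i)⁻¹ < R - δ)
    (hpp : ∀ i j, i ≠ j → gromovProd D 1 (a i) (a j) < R - δ)
    (hmm : ∀ i j, i ≠ j → gromovProd D 1 (a i)⁻¹ (a j)⁻¹ < R - δ)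
    (hpm : ∀ i j, i ≠ j → gromovProd D 1 (a i) (a j)⁻¹ < R - δ) :
    Function.Injective (FreeGroup.lift a) := by
  have hdisj : ∀ s t : B, gromovProd D 1 s t < R - δ →
      Disjoint {x | R ≤ gromovProd D 1 x s} {x | R ≤ gromovProd D 1 x t} := by
    intro s t hst
    rw [Set.disjoint_left]
    intro x hs ht
    have h1 := hD.hyp 1 s x t
    rw [Set.mem_ofPred_eq] at hs ht
    rw [hD.gromovProd_comm] at hs
    have h2 := le_min hs ht
    linarith
  have hmove : ∀ s : B, 2 * R ≤ D 1 s →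
      s • {x | R ≤ gromovProd D 1 x s⁻¹}ᶜ ⊆ {x | R ≤ gromovProd D 1 x s} := by
    rintro s hs _ ⟨x, hx, rfl⟩
    have h1 := gromovProd_mul_left_self hD hinv s x
    simp only [Set.mem_compl_iff, Set.mem_ofPred_eq, not_le, smul_eq_mul] at hx ⊢
    linarith
  refine FreeGroup.injective_lift_of_ping_pong a (fun i => {x | R ≤ gromovProd D 1 x (a i)})
    (fun i => {x | R ≤ gromovProd D 1 x (a i)⁻¹}) (fun i => ⟨a i, ?_⟩)
    (fun i j hij => hdisj _ _ (hpp i j hij)) (fun i j hij => hdisj _ _ (hmm i j hij))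
    (fun i j => hdisj _ _ ?_) (fun i => hmove _ (hlong i)) (fun i => ?_)
  · have := hlong i
    simp only [Set.mem_ofPred_eq, gromovProd, hD.self]
    linarith
  · rcases eq_or_ne i j with rfl | hij
    · exact hself i
    · exact hpm i j hij
  · have h := hmove (a i)⁻¹ ((hlong i).trans_eq (dist_one_inv hD hinv _).symm)
    rwa [inv_inv] at h

section Loxodromic

variable {B : Type} [Group B] {D : B → B → ℝ} {δ M : ℝ} {b : B}

theorem eventually_gromovProd_conj_le {s t g : B} {M' : ℝ} (hD : IsHypDist δ D)
    (hinv : ∀ k g h, D (k * g) (k * h) = D g h) (hs : IsLoxodromic D M s)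
    (ht : IsLoxodromic D M' t) (h : g • endPow D s ≠ endPow D t) :
    ∃ R : ℝ, ∀ᶠ n : ℕ in atTop, gromovProd D 1 ((g * s * g⁻¹) ^ n) (t ^ n) ≤ R := by
  have hs' := hs.asymptotic_pow hD hinv
  have ht' := ht.asymptotic_pow hD hinv
  rw [endPow, smul_endOf hD hinv, endPow, Ne, endOf_eq_endOf_iff hD ht'] at h
  obtain ⟨R, N, hR⟩ := exists_gromovProd_le_of_not_asymptotic hD (hs'.smul hD hinv g) ht' h
  refine ⟨R + D 1 g⁻¹, eventually_atTop.2 ⟨N, fun n hn => ?_⟩⟩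
  have h1 := hR n hn n hn
  have h2 := hD.gromovProd_le_add_left 1 ((g * s * g⁻¹) ^ n) (g * s ^ n) (t ^ n)
  have h3 := hinv (g * s ^ n) g⁻¹ 1
  rw [mul_one, hD.symm g⁻¹] at h3
  rw [conj_pow] at h2 ⊢
  simp only [Pi.smul_apply, smul_eq_mul] at h1
  linarith

theorem IsLoxodromic.exists_injective_freeGroup (hb : IsLoxodromic D M b) (hD : IsHypDist δ D)
    (hinv : ∀ k g h, D (k * g) (k * h) = D g h) (g : B)
    (h₁ : g • endPow D b ≠ endPow D b) (h₂ : g • endPow D b ≠ endPow D b⁻¹)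
    (h₃ : g • endPow D b⁻¹ ≠ endPow D b) (h₄ : g • endPow D b⁻¹ ≠ endPow D b⁻¹) :
    ∃ φ : FreeGroup (Fin 2) →* B, Function.Injective φ := by
  have hb' := hb.inv hD hinv
  obtain ⟨R₁, e₁⟩ := eventually_gromovProd_conj_le hD hinv hb hb h₁
  obtain ⟨R₂, e₂⟩ := eventually_gromovProd_conj_le hD hinv hb hb' h₂
  obtain ⟨R₃, e₃⟩ := eventually_gromovProd_conj_le hD hinv hb' hb h₃
  obtain ⟨R₄, e₄⟩ := eventually_gromovProd_conj_le hD hinv hb' hb' h₄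
  set c := g * b * g⁻¹ with hc
  have hcinv : g * b⁻¹ * g⁻¹ = c⁻¹ := by rw [hc]; group
  rw [hcinv] at e₃ e₄
  have hcself : ∀ n : ℕ, gromovProd D 1 (c ^ n) (c⁻¹ ^ n) ≤ D 1 g + 2 * D 1 g + M := by
    intro n
    have i1 := hb.gromovProd_pow_inv_pow_le hD hinv n n
    have i2 := hD.gromovProd_le_base 1 g (g * b ^ n * g⁻¹) (g * b⁻¹ ^ n * g⁻¹)
    have i3 := hD.gromovProd_le_add_left g (g * b ^ n * g⁻¹) (g * b ^ n) (g * b⁻¹ ^ n * g⁻¹)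
    have i4 := hD.gromovProd_le_add_right g (g * b ^ n) (g * b⁻¹ ^ n * g⁻¹) (g * b⁻¹ ^ n)
    have i5 : ∀ x : B, D (x * g⁻¹) x = D 1 g := fun x => by
      rw [← dist_one_inv hD hinv g, ← hinv x 1 g⁻¹, mul_one, hD.symm]
    have i6 := gromovProd_mul_mul hinv g 1 (b ^ n) (b⁻¹ ^ n)
    rw [i5] at i3 i4
    rw [mul_one] at i6
    rw [← hcinv, hc, conj_pow, conj_pow]
    linarith
  have hclong : ∀ n : ℕ, D 1 (b ^ n) - 2 * D 1 g ≤ D 1 (c ^ n) := by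
    intro n
    have i1 := hD.triangle g (c ^ n * g) (c ^ n)
    have i2 := hinv (c ^ n) g 1
    have i3 := hD.triangle g 1 (c ^ n)
    have i4 := hD.triangle g (c ^ n) (g * b ^ n)
    have i5 := hinv g 1 (b ^ n)
    have i6 := hinv (g * b ^ n * g⁻¹) 1 g
    rw [inv_mul_cancel_right, mul_one] at i6
    rw [mul_one] at i5 i2
    rw [hc, conj_pow] at *
    rw [hD.symm g 1] at i3
    linarith
  set R := |R₁| + |R₂| + |R₃| + |R₄| + (D 1 g + 2 * D 1 g + |M|) + |δ| + 1 with hRdef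
  have hg := hD.nonneg 1 g
  have hR : 0 ≤ R := by positivity
  obtain ⟨n, ⟨⟨⟨f₁, f₂⟩, f₃⟩, f₄⟩, hn⟩ := ((((e₁.and e₂).and e₃).and e₄).and
    (hb.tendsto.eventually_ge_atTop (2 * R + 2 * D 1 g))).exists
  have a₁ := le_abs_self R₁
  have a₂ := le_abs_self R₂
  have a₃ := le_abs_self R₃
  have a₄ := le_abs_self R₄
  have aM := le_abs_self M
  have aδ := le_abs_self δ
  have p₁ := abs_nonneg R₁
  have p₂ := abs_nonneg R₂
  have p₃ := abs_nonneg R₃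
  have p₄ := abs_nonneg R₄
  have pM := abs_nonneg M
  have hbs := hb.gromovProd_pow_inv_pow_le hD hinv n n
  have hcs := hcself n
  have hcl := hclong n
  simp only [inv_pow] at hbs hcs f₁ f₂ f₃ f₄
  refine ⟨FreeGroup.lift ![b ^ n, c ^ n],
    injective_lift_of_gromovProd_lt hD hinv ![b ^ n, c ^ n] hR ?_ ?_ ?_ ?_ ?_⟩
  · simp only [Fin.forall_fin_two, Matrix.cons_val_zero, Matrix.cons_val_one]
    constructor <;> linarith
  · simp only [Fin.forall_fin_two, Matrix.cons_val_zero, Matrix.cons_val_one]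
    constructor <;> linarith
  · have := hD.gromovProd_comm 1 (b ^ n) (c ^ n)
    simp only [Fin.forall_fin_two, Matrix.cons_val_zero, Matrix.cons_val_one]
    refine ⟨⟨by simp, fun _ => ?_⟩, fun _ => ?_, by simp⟩ <;> linarith
  · have := hD.gromovProd_comm 1 (b ^ n)⁻¹ (c ^ n)⁻¹
    simp only [Fin.forall_fin_two, Matrix.cons_val_zero, Matrix.cons_val_one]
    refine ⟨⟨by simp, fun _ => ?_⟩, fun _ => ?_, by simp⟩ <;> linarith
  · have := hD.gromovProd_comm 1 (b ^ n) (c ^ n)⁻¹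
    simp only [Fin.forall_fin_two, Matrix.cons_val_zero, Matrix.cons_val_one]
    refine ⟨⟨by simp, fun _ => ?_⟩, fun _ => ?_, by simp⟩ <;> linarith

end Loxodromic

/-! ### Orbits of pairs of points -/

section Pairs

variable {B X : Type*} [Group B] [MulAction B X] {b : B}

theorem smul_eq_of_pairs_meet {r s : X} (hrs : r ≠ s) (hbr : b • r = r) (hbs : b • s = s)
    (hmeet : ∀ g : B, g • r = r ∨ g • s = r ∨ g • r = s ∨ g • s = s)
    (g : B) (c : X) (hcr : c ≠ r) (hcs : c ≠ s) (hbc : b • c ≠ c)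
    (hg : (g • r = r ∧ g • s = c) ∨ (g • s = r ∧ g • r = c)) (h : B) : h • r = r := by
  have hbcr : b • c ≠ r := fun e => hcr (smul_left_cancel b (e.trans hbr.symm))
  have hbcs : b • c ≠ s := fun e => hcs (smul_left_cancel b (e.trans hbs.symm))
  have mem : ∀ k : B, k • r = r ∨ k • s = r := by
    intro k
    have m1 := hmeet k
    have m2 := hmeet (g⁻¹ * k)
    have m3 := hmeet ((b * g)⁻¹ * k)
    simp only [mul_smul, inv_smul_eq_iff] at m2 m3
    grind
  by_contra hne
  have hs : h • s = r := (mem h).resolve_left hne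
  have m1 := mem h⁻¹
  have m2 := mem (h⁻¹ * g)
  simp only [mul_smul, inv_smul_eq_iff] at m1 m2
  grind

/-- If no translate of a pair is disjoint from it, then the group fixes one of the two points or
preserves the pair. -/
theorem fixes_or_preserves_of_pairs_meet {r s : X} (hrs : r ≠ s) (hbr : b • r = r)
    (hbs : b • s = s) (hfix : ∀ g : B, ∀ x : X, x = r ∨ x = s → b • g • x = g • x →
      g • x = r ∨ g • x = s)
    (hmeet : ∀ g : B, g • r = r ∨ g • s = r ∨ g • r = s ∨ g • s = s) :
    (∀ g : B, g • r = r) ∨ (∀ g : B, g • s = s) ∨ ∀ g : B, g • r = r ∨ g • r = s := by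
  by_cases hall : ∀ g : B, (g • r = r ∨ g • r = s) ∧ (g • s = r ∨ g • s = s)
  · exact Or.inr (Or.inr fun g => (hall g).1)
  · push Not at hall
    obtain ⟨g, hg⟩ := hall
    have hmeet' : ∀ g : B, g • s = s ∨ g • r = s ∨ g • s = r ∨ g • r = r := fun g => by
      have := hmeet g
      tauto
    have m := hmeet g
    have hr := hfix g r (Or.inl rfl)
    have hs := hfix g s (Or.inr rfl)
    have key := smul_eq_of_pairs_meet hrs hbr hbs hmeet g
    have key' := smul_eq_of_pairs_meet hrs.symm hbs hbr hmeet' g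
    by_cases h1 : g • r = r ∨ g • r = s
    · have h2 : g • s ≠ r ∧ g • s ≠ s := by tauto
      rcases h1 with h1 | h1
      · exact Or.inl (key (g • s) h2.1 h2.2 (by tauto) (by tauto))
      · exact Or.inr (Or.inl (key' (g • s) h2.2 h2.1 (by tauto) (by tauto)))
    · rw [not_or] at h1
      rcases (show g • s = r ∨ g • s = s by tauto) with h2 | h2
      · exact Or.inl (key (g • r) h1.1 h1.2 (by tauto) (by tauto))
      · exact Or.inr (Or.inl (key' (g • r) h1.2 h1.1 (by tauto) (by tauto)))

end Pairs

/-- The dichotomy for a loxodromic element of a group with an invariant hyperbolic pseudometric. -/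
theorem IsLoxodromic.free_or_isPseudocharacter {B : Type} [Group B] {D : B → B → ℝ} {δ M : ℝ}
    {b : B} (hb : IsLoxodromic D M b) (hD : IsHypDist δ D)
    (hinv : ∀ k g h, D (k * g) (k * h) = D g h) :
    (∃ φ : FreeGroup (Fin 2) →* B, Function.Injective φ) ∨
    (∃ H : Subgroup B, (H.index = 1 ∨ H.index = 2) ∧
      ∃ hbH : b ∈ H, ∃ p : H → ℝ, IsPseudocharacter p ∧ p ⟨b, hbH⟩ ≠ 0) := by
  have hb' := hb.inv hD hinv
  have hasy := hb.asymptotic_pow hD hinv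
  have hasy' := hb'.asymptotic_pow hD hinv
  by_cases hmeet : ∀ g : B, g • endPow D b = endPow D b ∨ g • endPow D b⁻¹ = endPow D b ∨
      g • endPow D b = endPow D b⁻¹ ∨ g • endPow D b⁻¹ = endPow D b⁻¹
  · right
    have hbr := hb.smul_endPow_self hD hinv
    rcases fixes_or_preserves_of_pairs_meet (hb.endPow_ne_endPow_inv hD hinv) hbr
      (hb.smul_endPow_inv hD hinv) (fun g x hx hfix => by
        rcases hx with rfl | rfl
        · rw [endPow, smul_endOf hD hinv] at hfix ⊢
          exact hb.endOf_eq_of_smul_eq hD hinv (hasy.smul hD hinv g) hfix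
        · rw [endPow, smul_endOf hD hinv] at hfix ⊢
          exact hb.endOf_eq_of_smul_eq hD hinv (hasy'.smul hD hinv g) hfix) hmeet with h | h | h
    · exact ⟨⊤, Or.inl Subgroup.index_top, Subgroup.mem_top b,
        hb.exists_isPseudocharacter hD hinv ⊤ (Subgroup.mem_top b) fun g _ => h g⟩
    · refine ⟨⊤, Or.inl Subgroup.index_top, Subgroup.mem_top b, ?_⟩
      obtain ⟨p, hp, hpb⟩ := hb'.exists_isPseudocharacter hD hinv ⊤ (Subgroup.mem_top b⁻¹)
        fun g _ => h g
      refine ⟨p, hp, fun h0 => hpb ?_⟩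
      have := hp.2 ⟨b, Subgroup.mem_top b⟩ (-1)
      rwa [h0, mul_zero, zpow_neg_one] at this
    · refine ⟨MulAction.stabilizer B (endPow D b), ?_, hbr,
        hb.exists_isPseudocharacter hD hinv _ hbr fun g hg => hg⟩
      have hsub : MulAction.orbit B (endPow D b) ⊆ {endPow D b, endPow D b⁻¹} := by
        rintro _ ⟨g, rfl⟩
        exact h g
      have hfin : (MulAction.orbit B (endPow D b)).Finite := (Set.toFinite _).subset hsub
      have h1 := (Set.ncard_le_ncard hsub).trans_eq
        (Set.ncard_pair (hb.endPow_ne_endPow_inv hD hinv))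
      have h2 := (Set.ncard_pos hfin).2 (MulAction.nonempty_orbit (endPow D b))
      rw [MulAction.index_stabilizer]
      omega
  · left
    push Not at hmeet
    obtain ⟨g, h1, h2, h3, h4⟩ := hmeet
    exact hb.exists_injective_freeGroup hD hinv g h1 h3 h2 h4

/-! ### Chains and quasigeodesics in zero-hyperbolic pseudometrics -/

namespace IsHypDist

variable {α : Type*} {d : α → α → ℝ} {γ : ℕ → α} {n : ℕ} {L : ℝ}

theorem exists_dist_le_of_chain (hd : IsHypDist 0 d) (hL : 0 ≤ L)
    (hγ : ∀ i < n, d (γ i) (γ (i + 1)) ≤ L) (p : α) :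
    ∃ j ≤ n, d p (γ j) ≤ gromovProd d p (γ 0) (γ n) + L := by
  induction n with
  | zero =>
    refine ⟨0, le_rfl, ?_⟩
    simp only [gromovProd, hd.self]
    linarith
  | succ n ih =>
    obtain ⟨j, hj, hjd⟩ := ih fun i hi => hγ i (by omega)
    have h1 := hd.hyp p (γ 0) (γ n) (γ (n + 1))
    have h2 := hd.sub_le_gromovProd p (γ n) (γ (n + 1))
    have h3 := hγ n (by omega)
    rcases min_choice (gromovProd d p (γ 0) (γ n)) (gromovProd d p (γ n) (γ (n + 1))) with h | h <;>
      rw [h] at h1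
    · exact ⟨j, by omega, by linarith⟩
    · exact ⟨n, by omega, by linarith⟩

theorem dist_le_mul_of_chain (hd : IsHypDist 0 d) (hγ : ∀ i < n, d (γ i) (γ (i + 1)) ≤ L) :
    d (γ 0) (γ n) ≤ L * n := by
  induction n with
  | zero => simp [hd.self]
  | succ n ih =>
    have h1 := ih fun i hi => hγ i (by omega)
    have h2 := hd.triangle (γ 0) (γ n) (γ (n + 1))
    have h3 := hγ n (by omega)
    push_cast
    linarith

theorem exists_escape (hd : IsHypDist 0 d) (hL : 0 ≤ L) (hγ : ∀ i < n, d (γ i) (γ (i + 1)) ≤ L)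
    {R : ℝ} (hR₀ : 0 ≤ R) (hR : R ≤ d (γ 0) (γ n)) :
    ∃ t ≤ n, d (γ 0) (γ t) ≤ R + L ∧ R - L ≤ gromovProd d (γ 0) (γ t) (γ n) := by
  classical
  have hex : ∃ t, t ≤ n ∧ ∀ i, t ≤ i → i ≤ n → R ≤ d (γ 0) (γ i) :=
    ⟨n, le_rfl, fun i hi hi' => by rwa [le_antisymm hi' hi]⟩
  obtain ⟨htn, ht⟩ := Nat.find_spec hex
  set t := Nat.find hex with ht_def
  refine ⟨t, htn, ?_, ?_⟩
  · rcases Nat.eq_zero_or_pos t with h0 | hpos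
    · rw [h0, hd.self]
      linarith
    · have hmin := Nat.find_min hex (m := t - 1) (by omega)
      have hlt : d (γ 0) (γ (t - 1)) < R := by
        by_contra! hge
        refine hmin ⟨by omega, fun i hi hi' => ?_⟩
        rcases Nat.eq_or_lt_of_le hi with rfl | hlt
        · exact hge
        · exact ht i (by omega) hi'
      have h1 := hγ (t - 1) (by omega)
      have h2 := hd.triangle (γ 0) (γ (t - 1)) (γ t)
      rw [Nat.sub_add_cancel hpos] at h1
      linarith
  · obtain ⟨j, hj, hjd⟩ := hd.exists_dist_le_of_chain (γ := fun i => γ (t + i)) (n := n - t) hL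
      (fun i hi => hγ (t + i) (by omega)) (γ 0)
    have h1 := ht (t + j) (by omega) (by omega)
    simp only [add_zero, Nat.add_sub_cancel' htn] at hjd
    linarith

/-- Stability of quasigeodesics: a point on a quasigeodesic is coarsely between its endpoints. -/
theorem gromovProd_le_of_quasigeodesic (hd : IsHypDist 0 d) (hL : 0 ≤ L) {κ c : ℝ} (hκ : 0 ≤ κ)
    (hγ : ∀ i < n, d (γ i) (γ (i + 1)) ≤ L)
    (hqg : ∀ i j : ℕ, i ≤ j → j ≤ n → (j : ℝ) - i ≤ κ * d (γ i) (γ j) + c) {j : ℕ} (hj : j ≤ n) :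
    gromovProd d (γ j) (γ 0) (γ n) ≤ L + L * (κ * (4 * L) + c) := by
  set R := gromovProd d (γ j) (γ 0) (γ n) with hR
  have hR₀ : 0 ≤ R := hd.gromovProd_nonneg _ _ _
  have hfwd : ∀ i < n - j, d (γ (j + i)) (γ (j + (i + 1))) ≤ L := fun i hi => hγ (j + i) (by omega)
  have hbwd : ∀ i < j, d (γ (j - i)) (γ (j - (i + 1))) ≤ L := fun i hi => by
    have := hγ (j - (i + 1)) (by omega)
    rwa [show j - (i + 1) + 1 = j - i by omega, hd.symm] at this
  obtain ⟨t, ht, ht1, ht2⟩ := hd.exists_escape (γ := fun i => γ (j + i)) hL hfwd hR₀ (by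
    simpa only [add_zero, Nat.add_sub_cancel' hj] using hd.gromovProd_le_right (γ j) (γ 0) (γ n))
  obtain ⟨s, hs, hs1, hs2⟩ := hd.exists_escape (γ := fun i => γ (j - i)) hL hbwd hR₀ (by
    simpa only [Nat.sub_zero, Nat.sub_self] using hd.gromovProd_le_left (γ j) (γ 0) (γ n))
  simp only [add_zero, Nat.add_sub_cancel' hj, Nat.sub_zero, Nat.sub_self] at ht1 ht2 hs1 hs2
  have h1 := hd.hyp (γ j) (γ (j - s)) (γ 0) (γ n)
  have h2 := hd.hyp (γ j) (γ (j - s)) (γ n) (γ (j + t))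
  rw [hd.gromovProd_comm _ (γ n) (γ (j + t))] at h2
  have h3 : R - L ≤ gromovProd d (γ j) (γ (j - s)) (γ n) := by
    have := le_min hs2 (show R - L ≤ gromovProd d (γ j) (γ 0) (γ n) by linarith)
    linarith
  have h4 : R - L ≤ gromovProd d (γ j) (γ (j - s)) (γ (j + t)) := by
    have := le_min h3 ht2
    linarith
  have h5 : d (γ (j - s)) (γ (j + t)) ≤ 4 * L := by
    simp only [gromovProd] at h4
    linarith
  have h6 := hqg (j - s) (j + t) (by omega) (by omega)
  have h7 := hd.dist_le_mul_of_chain (γ := fun i => γ (j + i)) (n := t) fun i hi =>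
    hfwd i (by omega)
  have h8 := hd.gromovProd_le_left (γ j) (γ (j + t)) (γ n)
  have h9 : (t : ℝ) ≤ κ * (4 * L) + c := by
    have : κ * d (γ (j - s)) (γ (j + t)) ≤ κ * (4 * L) := by gcongr
    push_cast [Nat.cast_sub hs] at h6
    have : (0 : ℝ) ≤ s := by positivity
    linarith
  have h10 : L * t ≤ L * (κ * (4 * L) + c) := by gcongr
  simp only [add_zero] at h7
  linarith

end IsHypDist

/-! ### Geodesics in graphs -/

namespace SimpleGraph

variable {V : Type*} {G : SimpleGraph V}

theorem Walk.dist_getVert_of_length_eq_dist {x z : V} (w : G.Walk x z) (hG : G.Connected)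
    (hw : w.length = G.dist x z) {i : ℕ} (hi : i ≤ w.length) :
    G.dist x (w.getVert i) = i ∧ G.dist (w.getVert i) z = w.length - i := by
  have h1 := dist_le (w.take i)
  have h2 := dist_le (w.drop i)
  have h3 := hG.dist_triangle (u := x) (v := w.getVert i) (w := z)
  rw [Walk.take_length] at h1
  rw [Walk.drop_length] at h2
  omega

theorem Walk.dist_add_dist_of_mem_support {x z p : V} (w : G.Walk x z) (hG : G.Connected)
    (hw : w.length = G.dist x z) (hp : p ∈ w.support) :
    G.dist x p + G.dist p z = G.dist x z := by
  obtain ⟨i, rfl, hi⟩ := Walk.mem_support_iff_exists_getVert.1 hp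
  have := w.dist_getVert_of_length_eq_dist hG hw hi
  omega

theorem IsTree.mem_support_of_dist_add_dist (hG : G.IsTree) {x p z : V}
    (hp : G.dist x p + G.dist p z = G.dist x z) (w : G.Walk x z) : p ∈ w.support := by
  classical
  obtain ⟨w₁, hw₁⟩ := hG.connected.exists_walk_length_eq_dist x p
  obtain ⟨w₂, hw₂⟩ := hG.connected.exists_walk_length_eq_dist p z
  have hpath : (w₁.append w₂).IsPath := by
    apply Walk.isPath_of_length_eq_dist
    rw [Walk.length_append]
    omega
  have heq := congrArg Subtype.val
    ((hG.isAcyclic.subsingleton_path _ _).elim ⟨_, hpath⟩ ⟨_, w.bypass_isPath⟩)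
  simp only at heq
  apply w.support_bypass_subset_support
  rw [← heq, Walk.mem_support_append_iff]
  exact Or.inl w₁.end_mem_support

/-- Geodesic triangles in trees are tripods. -/
theorem IsTree.dist_add_dist_of_dist_add_dist (hG : G.IsTree) {x p z : V}
    (hp : G.dist x p + G.dist p z = G.dist x z) (y : V) :
    G.dist x p + G.dist p y = G.dist x y ∨ G.dist y p + G.dist p z = G.dist y z := by
  obtain ⟨w₁, hw₁⟩ := hG.connected.exists_walk_length_eq_dist x y
  obtain ⟨w₂, hw₂⟩ := hG.connected.exists_walk_length_eq_dist y z
  have := hG.mem_support_of_dist_add_dist hp (w₁.append w₂)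
  rw [Walk.mem_support_append_iff] at this
  exact this.imp (w₁.dist_add_dist_of_mem_support hG.connected hw₁)
    (w₂.dist_add_dist_of_mem_support hG.connected hw₂)

theorem IsTree.exists_median (hG : G.IsTree) (x z o : V) :
    ∃ m, G.dist x m + G.dist m z = G.dist x z ∧ G.dist x m + G.dist m o = G.dist x o ∧
      G.dist o m + G.dist m z = G.dist o z := by
  classical
  obtain ⟨w, hw⟩ := hG.connected.exists_walk_length_eq_dist x z
  set P : ℕ → Prop := fun i => G.dist x (w.getVert i) + G.dist (w.getVert i) o = G.dist x o with hP
  have h0 : P 0 := by simp [hP]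
  set i := Nat.findGreatest P w.length
  have hi : i ≤ w.length := Nat.findGreatest_le _
  have hPi : P i := Nat.findGreatest_spec (Nat.zero_le _) h0
  obtain ⟨e1, e2⟩ := w.dist_getVert_of_length_eq_dist hG.connected hw hi
  refine ⟨w.getVert i, by omega, hPi, ?_⟩
  rcases hi.eq_or_lt with heq | hlt
  · rw [heq, Walk.getVert_length, dist_self, add_zero]
  · have hnot : ¬ P (i + 1) := Nat.findGreatest_is_greatest (Nat.lt_succ_self i) hlt
    obtain ⟨e3, e4⟩ := w.dist_getVert_of_length_eq_dist hG.connected hw (i := i + 1) hlt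
    have h1 := hG.dist_eq_dist_add_one_of_adj o (w.adj_getVert_succ hlt)
    have h2 := (hG.dist_add_dist_of_dist_add_dist
      (p := w.getVert (i + 1)) (x := x) (z := z) (by omega) o).resolve_left hnot
    have e5 : G.dist (w.getVert i) o = G.dist o (w.getVert i) := dist_comm
    have e6 : G.dist (w.getVert (i + 1)) o = G.dist o (w.getVert (i + 1)) := dist_comm
    simp only [hP] at hPi hnot
    omega

theorem IsTree.isHypDist (hG : G.IsTree) : IsHypDist 0 fun u v => (G.dist u v : ℝ) where
  self x := by simp
  symm x y := by rw [dist_comm]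
  triangle x y z := by exact_mod_cast hG.connected.dist_triangle
  hyp o x y z := by
    obtain ⟨m, h1, h2, h3⟩ := hG.exists_median x z o
    have key : ∀ u v : V, G.dist u m + G.dist m v = G.dist u v →
        gromovProd (fun u v => (G.dist u v : ℝ)) o u v ≤ G.dist o m := by
      intro u v h
      have i1 := hG.connected.dist_triangle (u := o) (v := m) (w := u)
      have i2 := hG.connected.dist_triangle (u := o) (v := m) (w := v)
      have i3 : G.dist u m = G.dist m u := dist_comm
      have : (G.dist o u : ℝ) + G.dist o v - G.dist u v ≤ 2 * G.dist o m := by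
        have : G.dist o u + G.dist o v ≤ 2 * G.dist o m + G.dist u v := by omega
        have : (G.dist o u : ℝ) + G.dist o v ≤ 2 * G.dist o m + G.dist u v := by exact_mod_cast this
        linarith
      simp only [gromovProd]
      linarith
    have hxz : gromovProd (fun u v => (G.dist u v : ℝ)) o x z = G.dist o m := by
      have e1 : G.dist m o = G.dist o m := dist_comm
      have e2 : G.dist o x = G.dist x o := dist_comm
      have : G.dist o x + G.dist o z = 2 * G.dist o m + G.dist x z := by omega
      have : (G.dist o x : ℝ) + G.dist o z = 2 * G.dist o m + G.dist x z := by exact_mod_cast this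
      simp only [gromovProd]
      linarith
    rw [hxz, sub_zero, min_le_iff]
    exact (hG.dist_add_dist_of_dist_add_dist h1 y).imp (key x y) (key y z)

/-- A connected graph whose path metric is quasi-isometric to a zero-hyperbolic pseudometric `d`
is hyperbolic, and bounded Gromov products for `d` give bounded Gromov products in the graph. -/
theorem Connected.isHypDist_of_quasiisometry (hG : G.Connected) {d : V → V → ℝ}
    (hd : IsHypDist 0 d) {L : ℝ} (hL : 0 ≤ L) (hstep : ∀ u v, G.Adj u v → d u v ≤ L)
    (hle : ∀ u v, (G.dist u v : ℝ) ≤ d u v + 2) :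
    (∃ δ, IsHypDist δ fun u v => (G.dist u v : ℝ)) ∧
    ∀ p x y, gromovProd (fun u v => (G.dist u v : ℝ)) p x y ≤ gromovProd d p x y + L + 2 := by
  set D : V → V → ℝ := fun u v => (G.dist u v : ℝ) with hD
  have hsymm : ∀ u v, D u v = D v u := fun u v => by simp only [hD, dist_comm]
  have htri : ∀ u v w, D u w ≤ D u v + D v w := fun u v w => by
    simp only [hD]
    exact_mod_cast hG.dist_triangle (u := u) (v := v) (w := w)
  have hbase : ∀ o p x y, gromovProd D o x y ≤ D o p + gromovProd D p x y := fun o p x y => by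
    have h1 := htri o p x
    have h2 := htri o p y
    simp only [gromovProd]
    linarith
  have hcomp : ∀ p x y, gromovProd D p x y ≤ gromovProd d p x y + L + 2 := by
    intro p x y
    obtain ⟨w, hw⟩ := hG.exists_walk_length_eq_dist x y
    obtain ⟨j, hj, hjd⟩ := hd.exists_dist_le_of_chain (γ := w.getVert) hL
      (fun i hi => hstep _ _ (w.adj_getVert_succ hi)) p
    rw [Walk.getVert_zero, Walk.getVert_length] at hjd
    have h1 := hbase p (w.getVert j) x y
    have h2 := hle p (w.getVert j)
    have h3 : gromovProd D (w.getVert j) x y = 0 := by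
      have := w.dist_add_dist_of_mem_support hG hw (w.getVert_mem_support j)
      simp only [gromovProd, hsymm (w.getVert j) x]
      simp only [hD, ← this]
      push_cast
      ring
    simp only [hD] at h1 h2 h3
    linarith
  refine ⟨⟨3 * (L + L * (1 * (4 * L) + 2) + L + L + 2), fun x => by simp [hD], hsymm, htri,
    fun o x y z => ?_⟩, hcomp⟩
  set M := L + L * (1 * (4 * L) + 2) with hM
  have hM₀ : 0 ≤ M := by positivity
  obtain ⟨p, hp1, hp2, hp3⟩ : ∃ p, gromovProd d p x o ≤ M + L ∧ gromovProd d p o z ≤ M + L ∧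
      gromovProd d p x z ≤ M := by
    classical
    obtain ⟨w, hw⟩ := hG.exists_walk_length_eq_dist x z
    have hchain : ∀ i < w.length, d (w.getVert i) (w.getVert (i + 1)) ≤ L :=
      fun i hi => hstep _ _ (w.adj_getVert_succ hi)
    have hmorse : ∀ i ≤ w.length, gromovProd d (w.getVert i) x z ≤ M := by
      intro i hi
      have := hd.gromovProd_le_of_quasigeodesic (γ := w.getVert) (n := w.length) (κ := 1) (c := 2)
        hL zero_le_one hchain (fun i j hij hj => by
          have h1 := (w.dist_getVert_of_length_eq_dist hG hw (hij.trans hj)).1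
          have h2 := (w.dist_getVert_of_length_eq_dist hG hw hj).1
          have h3 := htri x (w.getVert i) (w.getVert j)
          have h4 := hle (w.getVert i) (w.getVert j)
          simp only [hD, h1, h2] at h3
          linarith) hi
      rwa [Walk.getVert_zero, Walk.getVert_length] at this
    set P : ℕ → Prop := fun i => gromovProd d (w.getVert i) x o ≤ M with hP
    have h0 : P 0 := by
      have := hd.gromovProd_le_left x x o
      rw [hd.self] at this
      simp only [hP, Walk.getVert_zero]
      linarith
    set i := Nat.findGreatest P w.length
    have hi : i ≤ w.length := Nat.findGreatest_le _
    have hPi : P i := Nat.findGreatest_spec (Nat.zero_le _) h0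
    refine ⟨w.getVert i, by linarith [show gromovProd d (w.getVert i) x o ≤ M from hPi], ?_,
      hmorse i hi⟩
    rcases hi.eq_or_lt with heq | hlt
    · have := hd.gromovProd_le_right z o z
      rw [hd.self] at this
      rw [heq, Walk.getVert_length]
      linarith
    · have hnot : ¬ P (i + 1) := Nat.findGreatest_is_greatest (Nat.lt_succ_self i) hlt
      have h1 := hd.hyp (w.getVert (i + 1)) x o z
      have h2 := hmorse (i + 1) hlt
      have h3 := hd.gromovProd_le_base (w.getVert i) (w.getVert (i + 1)) o z
      have h4 := hchain i hlt
      rw [sub_zero, min_le_iff] at h1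
      have h5 := h1.resolve_left fun h => hnot (h.trans h2)
      linarith
  have q1 := hcomp p x o
  have q2 := hcomp p o z
  have q3 := htri x p z
  have q4 := hsymm x p
  have q5 := hsymm x o
  have q6 := hsymm p o
  have hlow : D o p - 2 * (M + L + L + 2) ≤ gromovProd D o x z := by
    simp only [gromovProd] at *
    linarith
  have hmid : min (gromovProd D o x y) (gromovProd D o y z) ≤ D o p + (M + L + L + 2) := by
    have h1 := hd.hyp p x y z
    rw [sub_zero, min_le_iff] at h1
    rcases h1 with h1 | h1
    · have h2 := hcomp p x y
      have h3 := hbase o p x y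
      exact (min_le_left _ _).trans (by linarith)
    · have h2 := hcomp p y z
      have h3 := hbase o p y z
      exact (min_le_right _ _).trans (by linarith)
  linarith

end SimpleGraph

/-! ### The group as a hyperbolic graph -/

section StepGraph

variable {B : Type*} [Group B] {d : B → B → ℝ} {L : ℝ}

/-- The left-invariant graph on `B` joining elements all of whose translates are `L`-close. -/
def stepGraph (d : B → B → ℝ) (L : ℝ) : SimpleGraph B where
  Adj g h := g ≠ h ∧ ∀ k, d (k * g) (k * h) ≤ L ∧ d (k * h) (k * g) ≤ L
  symm := ⟨fun _ _ h => ⟨h.1.symm, fun k => (h.2 k).symm⟩⟩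
  loopless := ⟨fun _ h => h.1 rfl⟩

theorem stepGraph_mono {L' : ℝ} (h : L ≤ L') : stepGraph d L ≤ stepGraph d L' :=
  fun _ _ hadj => ⟨hadj.1, fun k => ⟨(hadj.2 k).1.trans h, (hadj.2 k).2.trans h⟩⟩

/-- Left multiplication as a graph homomorphism of the step graph. -/
def stepGraphMulLeft (d : B → B → ℝ) (L : ℝ) (k : B) : stepGraph d L →g stepGraph d L where
  toFun g := k * g
  map_rel' h := ⟨fun e => h.1 (mul_left_cancel e), fun k' => by
    simpa only [← mul_assoc] using h.2 (k' * k)⟩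

theorem stepGraph_dist_mul_left (hc : (stepGraph d L).Connected) (k g h : B) :
    (stepGraph d L).dist (k * g) (k * h) = (stepGraph d L).dist g h := by
  have key : ∀ k g h : B, (stepGraph d L).dist (k * g) (k * h) ≤ (stepGraph d L).dist g h := by
    intro k g h
    obtain ⟨w, hw⟩ := hc.exists_walk_length_eq_dist g h
    have := SimpleGraph.dist_le (w.map (stepGraphMulLeft d L k))
    rw [SimpleGraph.Walk.length_map, hw] at this
    exact this
  refine le_antisymm (key k g h) ?_
  simpa using key k⁻¹ (k * g) (k * h)

variable {K C : ℝ}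

theorem IsHypDist.stepGraph_adj_or_eq {δ : ℝ} (hd : IsHypDist δ d) (hK : 0 ≤ K)
    (hquasi : ∀ k g h, d (k * g) (k * h) ≤ K * d g h + C) {r : ℝ} {g h : B} (hr : d g h ≤ r) :
    g = h ∨ (stepGraph d (K * r + C)).Adj g h := by
  refine or_iff_not_imp_left.2 fun hne => ⟨hne, fun k => ?_⟩
  have : K * d g h ≤ K * r := by gcongr
  rw [hd.symm (k * h)]
  have := hquasi k g h
  constructor <;> linarith

theorem IsHypDist.exists_stepGraph_connected {δ : ℝ} (hd : IsHypDist δ d) (hFG : Group.FG B)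
    (hK : 0 ≤ K) (hquasi : ∀ k g h, d (k * g) (k * h) ≤ K * d g h + C) :
    ∃ L, (stepGraph d L).Connected := by
  obtain ⟨S, hS⟩ := hFG.out
  refine ⟨K * ∑ s ∈ S, d 1 s + C, ?_⟩
  set G := stepGraph d (K * ∑ s ∈ S, d 1 s + C)
  have htrans : ∀ k g h, G.Reachable g h → G.Reachable (k * g) (k * h) :=
    fun k g h hr => hr.map (stepGraphMulLeft _ _ k)
  have key : ∀ h : B, G.Reachable 1 h := by
    intro h
    have hh : h ∈ Subgroup.closure (S : Set B) := hS ▸ Subgroup.mem_top h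
    induction hh using Subgroup.closure_induction with
    | mem s hs =>
      have hle : d 1 s ≤ ∑ s ∈ S, d 1 s :=
        Finset.single_le_sum (f := fun s => d 1 s) (fun t _ => hd.nonneg 1 t) hs
      rcases hd.stepGraph_adj_or_eq hK hquasi hle with h | h
      · exact h ▸ SimpleGraph.Reachable.refl _
      · exact h.reachable
    | one => exact SimpleGraph.Reachable.refl _
    | mul x y _ _ hx hy =>
      have := htrans x _ _ hy
      rw [mul_one] at this
      exact hx.trans this
    | inv x _ hx =>
      have := htrans x⁻¹ _ _ hx
      rw [mul_one, inv_mul_cancel] at this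
      exact this.symm
  exact (SimpleGraph.connected_iff _).2 ⟨fun g h => (key g).symm.trans (key h), ⟨1⟩⟩

end StepGraph

theorem SimpleGraph.Connected.dist_le_of_chain {V : Type*} {G : SimpleGraph V} (hG : G.Connected)
    {γ : ℕ → V} {n : ℕ} (hγ : ∀ i < n, γ i = γ (i + 1) ∨ G.Adj (γ i) (γ (i + 1))) :
    G.dist (γ 0) (γ n) ≤ n := by
  induction n with
  | zero => simp
  | succ n ih =>
    have h1 := ih fun i hi => hγ i (by omega)
    have h2 := hG.dist_triangle (u := γ 0) (v := γ n) (w := γ (n + 1))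
    rcases hγ n (by omega) with h | h
    · rw [← h]
      omega
    · have := SimpleGraph.dist_eq_one_iff_adj.2 h
      omega

section Orbit

variable {B V : Type*} [Group B] {T : SimpleGraph V} {f : B → V} {K C : ℝ}

/-- A coarsely equivariant map from a finitely generated group to a tree induces a left-invariant
path metric on the group whose step graph has coarsely the same distances. -/
theorem SimpleGraph.IsTree.exists_stepGraph (hT : T.IsTree) (hFG : Group.FG B) (hK : 1 ≤ K)
    (hC : 0 ≤ C) (hquasi : ∀ k g h,
      (T.dist (f (k * g)) (f (k * h)) : ℝ) ≤ K * (T.dist (f g) (f h) : ℝ) + C) :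
    ∃ L, 0 ≤ L ∧ (stepGraph (fun g h => (T.dist (f g) (f h) : ℝ)) L).Connected ∧
      ∀ g h, ((stepGraph (fun g h => (T.dist (f g) (f h) : ℝ)) L).dist g h : ℝ) ≤
        T.dist (f g) (f h) + 2 := by
  have hdV := hT.isHypDist
  have hd : IsHypDist 0 fun g h => (T.dist (f g) (f h) : ℝ) := hdV.comap f
  have hK₀ : 0 ≤ K := zero_le_one.trans hK
  set d : B → B → ℝ := fun g h => (T.dist (f g) (f h) : ℝ) with hd_def
  obtain ⟨L₀, hL₀⟩ := hd.exists_stepGraph_connected hFG hK₀ hquasi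
  set L₁ := max L₀ 0
  have hL₁ : 0 ≤ L₁ := le_max_right _ _
  have hc₁ : (stepGraph d L₁).Connected := hL₀.mono (stepGraph_mono (le_max_left _ _))
  have hnear : ∀ (g h : B) (v : V), T.dist (f g) v + T.dist v (f h) = T.dist (f g) (f h) →
      ∃ y, (T.dist v (f y) : ℝ) ≤ L₁ := by
    intro g h v hv
    obtain ⟨w, -⟩ := hc₁.exists_walk_length_eq_dist g h
    obtain ⟨j, -, hjd⟩ := hdV.exists_dist_le_of_chain (γ := fun i => f (w.getVert i))
      (n := w.length) hL₁ (fun i hi => by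
        simpa using ((w.adj_getVert_succ hi).2 1).1) v
    refine ⟨w.getVert j, hjd.trans ?_⟩
    rw [SimpleGraph.Walk.getVert_zero, SimpleGraph.Walk.getVert_length]
    simp only [gromovProd]
    rw [← hv, SimpleGraph.dist_comm (u := v) (v := f g)]
    push_cast
    linarith
  refine ⟨K * (2 * L₁ + 1) + C, by positivity, hc₁.mono (stepGraph_mono ?_), fun g h => ?_⟩
  · nlinarith
  have hc : (stepGraph d (K * (2 * L₁ + 1) + C)).Connected :=
    hc₁.mono (stepGraph_mono (by nlinarith))
  obtain ⟨w, hw⟩ := hT.connected.exists_walk_length_eq_dist (f g) (f h)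
  have hex : ∀ i, ∃ y, (T.dist (w.getVert i) (f y) : ℝ) ≤ L₁ := fun i =>
    hnear g h _ (w.dist_add_dist_of_mem_support hT.connected hw (w.getVert_mem_support i))
  choose y hy using hex
  have hadj : ∀ {g h : B}, d g h ≤ 2 * L₁ + 1 →
      g = h ∨ (stepGraph d (K * (2 * L₁ + 1) + C)).Adj g h :=
    fun h => hd.stepGraph_adj_or_eq hK₀ hquasi h
  have hstep1 : ∀ {g h : B}, d g h ≤ 2 * L₁ + 1 →
      (stepGraph d (K * (2 * L₁ + 1) + C)).dist g h ≤ 1 := by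
    intro g h hgh
    rcases hadj hgh with h | h
    · simp [h]
    · exact (SimpleGraph.dist_eq_one_iff_adj.2 h).le
  have h1 := hc.dist_le_of_chain (γ := y) (n := w.length) fun i hi => hadj (by
    have t1 := hdV.triangle (f (y i)) (w.getVert i) (f (y (i + 1)))
    have t2 := hdV.triangle (w.getVert i) (w.getVert (i + 1)) (f (y (i + 1)))
    have t3 := hdV.symm (f (y i)) (w.getVert i)
    have t4 : (T.dist (w.getVert i) (w.getVert (i + 1)) : ℝ) = 1 := by
      exact_mod_cast SimpleGraph.dist_eq_one_iff_adj.2 (w.adj_getVert_succ hi)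
    have := hy i
    have := hy (i + 1)
    simp only [hd_def]
    linarith)
  have h2 := hstep1 (g := g) (h := y 0) (by
    have := hy 0
    rw [SimpleGraph.Walk.getVert_zero] at this
    simp only [hd_def]
    linarith)
  have h3 := hstep1 (g := y w.length) (h := h) (by
    have := hy w.length
    rw [SimpleGraph.Walk.getVert_length, SimpleGraph.dist_comm] at this
    simp only [hd_def]
    linarith)
  have h4 := hc.dist_triangle (u := g) (v := y 0) (w := h)
  have h5 := hc.dist_triangle (u := y 0) (v := y w.length) (w := h)
  rw [← hw]
  exact_mod_cast (by omega : (stepGraph d (K * (2 * L₁ + 1) + C)).dist g h ≤ w.length + 2)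

/-- A group element translating quasi-isometrically along its orbit in a tree is loxodromic for
a left-invariant hyperbolic metric on the group. -/
theorem SimpleGraph.IsTree.exists_isLoxodromic (hT : T.IsTree) (hFG : Group.FG B) (hK : 1 ≤ K)
    (hC : 0 ≤ C) (hquasi : ∀ k g h,
      (T.dist (f (k * g)) (f (k * h)) : ℝ) ≤ K * (T.dist (f g) (f h) : ℝ) + C)
    {b : B} {κ c : ℝ} (hκ : 0 < κ) (hb : ∀ m n : ℕ, m ≤ n →
      (n : ℝ) - m ≤ κ * (T.dist (f (b ^ m)) (f (b ^ n)) : ℝ) + c) :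
    ∃ (D : B → B → ℝ) (δ M : ℝ), IsHypDist δ D ∧ (∀ k g h, D (k * g) (k * h) = D g h) ∧
      IsLoxodromic D M b := by
  obtain ⟨L, hL, hconn, hle⟩ := hT.exists_stepGraph hFG hK hC hquasi
  have hdV := hT.isHypDist
  have hd : IsHypDist 0 fun g h => (T.dist (f g) (f h) : ℝ) := hdV.comap f
  set d : B → B → ℝ := fun g h => (T.dist (f g) (f h) : ℝ) with hd_def
  have hstep : ∀ u v, (stepGraph d L).Adj u v → d u v ≤ L := fun u v h => by
    simpa using (h.2 1).1
  obtain ⟨⟨δ, hδ⟩, hcomp⟩ := hconn.isHypDist_of_quasiisometry hd hL hstep hle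
  set D : B → B → ℝ := fun g h => ((stepGraph d L).dist g h : ℝ) with hD
  have hinv : ∀ k g h, D (k * g) (k * h) = D g h := fun k g h => by
    simp only [hD, stepGraph_dist_mul_left hconn]
  set ℓ := K * d 1 b + C
  have hℓ : 0 ≤ ℓ := by
    have := hd.nonneg 1 b
    positivity
  set N := ℓ + ℓ * (κ * (4 * ℓ) + c)
  refine ⟨D, δ, N + L + 2, hδ, hinv, ?_, ?_⟩
  · intro m n
    have h1 := hd.gromovProd_le_of_quasigeodesic (γ := fun i => b ^ i) (n := m + n) (j := m) hℓ
      hκ.le (fun i _ => by simpa only [mul_one, pow_succ] using hquasi (b ^ i) 1 b)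
      (fun i j hij _ => hb i j hij) (Nat.le_add_right m n)
    have h2 := hcomp (b ^ m) (b ^ 0) (b ^ (m + n))
    have h3 := hinv (b ^ m) 1 (b ^ n)
    have h4 := hδ.symm (b ^ m) 1
    rw [mul_one, ← pow_add] at h3
    simp only [pow_zero, gromovProd, h3, h4] at h1 h2
    linarith
  · have hlow : ∀ n : ℕ, ((n : ℝ) - c) / (κ * (L + 1)) ≤ D 1 (b ^ n) := by
      intro n
      obtain ⟨w, hw⟩ := hconn.exists_walk_length_eq_dist 1 (b ^ n)
      have h1 := hd.dist_le_mul_of_chain (γ := w.getVert) (n := w.length)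
        (fun i hi => hstep _ _ (w.adj_getVert_succ hi))
      rw [SimpleGraph.Walk.getVert_zero, SimpleGraph.Walk.getVert_length, hw] at h1
      have h2 := hb 0 n (Nat.zero_le n)
      rw [div_le_iff₀ (by positivity)]
      have h3 : d 1 (b ^ n) ≤ (L + 1) * D 1 (b ^ n) := by
        have : 0 ≤ D 1 (b ^ n) := hδ.nonneg _ _
        simp only [hD] at *
        linarith
      have h4 : κ * d 1 (b ^ n) ≤ κ * ((L + 1) * D 1 (b ^ n)) := by gcongr
      simp only [pow_zero, Nat.cast_zero, sub_zero] at h2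
      linarith
    refine tendsto_atTop_mono hlow (Tendsto.atTop_div_const (by positivity) ?_)
    exact tendsto_atTop_add_const_right _ _ tendsto_natCast_atTop_atTop

end Orbit

/-- if an element `b` of a finitely generated group `B` quasi-acts
hyperbolically in a quasi-action on a simplicial tree, then either `B` contains a free
subgroup of rank 2, or some subgroup of index at most 2 containing `b` carries a
pseudocharacter which is nonzero on `b`. -/
theorem stmt_11 (B : Type) [Group B] (hFG : Group.FG B)
    (V : Type) (T : SimpleGraph V) (hT : T.IsTree)
    (K C : ℝ) (hK : 1 ≤ K) (hC : 0 ≤ C)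
    (A : B → V → V)
    -- each A(g,−) is a (K,C)-quasi-isometry of the tree
    (hQI : ∀ g : B,
      (∀ u v : V, (T.dist u v : ℝ) / K - C ≤ (T.dist (A g u) (A g v) : ℝ) ∧
        (T.dist (A g u) (A g v) : ℝ) ≤ K * (T.dist u v : ℝ) + C) ∧
      ∀ v : V, ∃ u : V, (T.dist v (A g u) : ℝ) ≤ C)
    -- quasi-action cocycle condition
    (hcoc : ∀ g h : B, ∀ u : V, (T.dist (A g (A h u)) (A (g * h) u) : ℝ) ≤ C)
    (b : B)
    -- b quasi-acts hyperbolically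
    (hhyp : ∃ x : V, ∃ K' C' : ℝ, 1 ≤ K' ∧ 0 ≤ C' ∧
      ∀ m n : ℤ, |(m : ℝ) - (n : ℝ)| / K' - C' ≤ (T.dist (A (b ^ m) x) (A (b ^ n) x) : ℝ) ∧
        (T.dist (A (b ^ m) x) (A (b ^ n) x) : ℝ) ≤ K' * |(m : ℝ) - (n : ℝ)| + C') :
    (∃ φ : FreeGroup (Fin 2) →* B, Function.Injective φ) ∨
    (∃ H : Subgroup B, (H.index = 1 ∨ H.index = 2) ∧
      ∃ hbH : b ∈ H, ∃ p : H → ℝ, IsPseudocharacter p ∧ p ⟨b, hbH⟩ ≠ 0) := by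
  obtain ⟨x, K', C', hK', -, hx⟩ := hhyp
  have hK₀ : 0 < K' := by linarith
  have hquasi : ∀ k g h : B, (T.dist (A (k * g) x) (A (k * h) x) : ℝ) ≤
      K * (T.dist (A g x) (A h x) : ℝ) + 3 * C := by
    intro k g h
    have hdV := hT.isHypDist
    have h1 := hdV.triangle (A (k * g) x) (A k (A g x)) (A (k * h) x)
    have h2 := hdV.triangle (A k (A g x)) (A k (A h x)) (A (k * h) x)
    have h3 := hdV.symm (A (k * g) x) (A k (A g x))
    have h4 := hcoc k g x
    have h5 := hcoc k h x
    have h6 := ((hQI k).1 (A g x) (A h x)).2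
    linarith
  obtain ⟨D, δ, M, hD, hinv, hb⟩ := hT.exists_isLoxodromic (f := fun g => A g x) (b := b)
    (κ := K') (c := K' * C') hFG hK (by positivity) hquasi hK₀ fun m n hmn => by
      have h1 := (hx m n).1
      rw [sub_le_iff_le_add, div_le_iff₀ hK₀, zpow_natCast, zpow_natCast] at h1
      have h2 := neg_abs_le (((m : ℤ) : ℝ) - ((n : ℤ) : ℝ))
      push_cast at h1 h2
      linarith
  exact hb.free_or_isPseudocharacter hD hinv
end

section
/- Let G be a finitely generated group. Then G admits a cobounded quasi-action on ℝ (with its usual metric) if and only if there is a subgroup H ≤ G of index at most 2 which admits a nontrivial pseudocharacter. Equivalently: G has Property (QFA{ℝ}) (admits no cobounded quasi-action on ℝ) if and only if neither G nor any index 2 subgroup of G has a nontrivial pseudocharacter. -/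
/-- A (K,C)-quasi-action of `G` on a metric space `X`. -/
def IsQuasiAction {G X : Type*} [Group G] [MetricSpace X] (K C : ℝ) (A : G → X → X) : Prop :=
  (∀ g : G,
    (∀ x y : X, dist x y / K - C ≤ dist (A g x) (A g y) ∧
      dist (A g x) (A g y) ≤ K * dist x y + C) ∧
    ∀ y : X, ∃ x : X, dist y (A g x) ≤ C) ∧
  ∀ g h : G, ∀ x : X, dist (A g (A h x)) (A (g * h) x) ≤ C

/-! ### Homogenization of quasimorphisms -/

lemma abs_quasimorphism_pow_sub_le {G : Type*} [Group G] {f : G → ℝ} {D : ℝ}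
    (hf : ∀ g h : G, |f (g * h) - f g - f h| ≤ D) (g : G) (n : ℕ) :
    |f (g ^ (n + 1)) - (n + 1) * f g| ≤ n * D := by
  induction n with
  | zero => simp
  | succ n ih =>
    have h := hf (g ^ (n + 1)) g
    rw [← pow_succ] at h
    rw [abs_le] at *
    push_cast
    constructor <;> linarith

/-- A quasimorphism lies within its defect of a pseudocharacter. -/
lemma exists_pseudocharacter_near {G : Type*} [Group G] {f : G → ℝ} {D : ℝ}
    (hf : ∀ g h : G, |f (g * h) - f g - f h| ≤ D) :
    ∃ F : G → ℝ, IsPseudocharacter F ∧ ∀ g, |F g - f g| ≤ D := by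
  have hD : 0 ≤ D := (abs_nonneg _).trans (hf 1 1)
  have hlim : ∀ g : G, ∃ a : ℝ,
      Filter.Tendsto (fun n : ℕ => f (g ^ n) / n) Filter.atTop (nhds a) := by
    intro g
    have hsub : Subadditive (fun n : ℕ => f (g ^ n) + D) := by
      intro m n
      have h := (abs_le.1 (hf (g ^ m) (g ^ n))).2
      rw [← pow_add] at h
      linarith
    have hbdd : BddBelow (Set.range fun n : ℕ => (f (g ^ n) + D) / n) := by
      refine ⟨min 0 (f g - D), ?_⟩
      rintro _ ⟨n, rfl⟩
      rcases n with _ | n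
      · simp
      · refine (min_le_right _ _).trans ?_
        have h := (abs_le.1 (abs_quasimorphism_pow_sub_le hf g n)).1
        have hn : (0 : ℝ) < ((n + 1 : ℕ) : ℝ) := by positivity
        dsimp only
        rw [le_div_iff₀ hn]
        push_cast
        linarith
    refine ⟨hsub.lim, ?_⟩
    have h1 := hsub.tendsto_lim hbdd
    have h2 : Filter.Tendsto (fun n : ℕ => D / (n : ℝ)) Filter.atTop (nhds 0) :=
      tendsto_const_div_atTop_nhds_zero_nat D
    have h3 := h1.sub h2
    rw [sub_zero] at h3
    refine h3.congr fun n => ?_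
    rw [← sub_div, add_sub_cancel_right]
  choose F hF using hlim
  have hnear : ∀ g, |F g - f g| ≤ D := by
    intro g
    have h1 := ((hF g).sub_const (f g)).abs
    refine le_of_tendsto h1 ?_
    filter_upwards [Filter.eventually_gt_atTop 0] with n hn
    obtain ⟨n, rfl⟩ := Nat.exists_eq_succ_of_ne_zero hn.ne'
    have h := abs_quasimorphism_pow_sub_le hf g n
    have hn : (0 : ℝ) < ((n + 1 : ℕ) : ℝ) := by positivity
    have e : f (g ^ (n + 1)) / ((n + 1 : ℕ) : ℝ) - f g
        = (f (g ^ (n + 1)) - (n + 1) * f g) / ((n + 1 : ℕ) : ℝ) := by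
      push_cast
      field_simp
    rw [Nat.succ_eq_add_one, e, abs_div, abs_of_pos hn, div_le_iff₀ hn]
    push_cast
    linarith
  have hpow : ∀ (g : G) (k : ℕ), F (g ^ k) = k * F g := by
    intro g k
    rcases Nat.eq_zero_or_pos k with rfl | hk
    · have h1 : Filter.Tendsto (fun n : ℕ => f 1 / (n : ℝ)) Filter.atTop (nhds 0) :=
        tendsto_const_div_atTop_nhds_zero_nat _
      have h2 := hF (g ^ 0)
      simp only [pow_zero, one_pow] at h2
      simpa using tendsto_nhds_unique h2 h1
    · have h1 := ((hF g).comp (Filter.tendsto_id.const_mul_atTop' hk)).const_mul (k : ℝ)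
      refine tendsto_nhds_unique (hF (g ^ k)) (h1.congr fun n => ?_)
      have hk' : (k : ℝ) ≠ 0 := by positivity
      simp only [Function.comp, id, pow_mul, Nat.cast_mul]
      rw [← mul_div_assoc, mul_div_mul_left _ _ hk']
  have hinv : ∀ g : G, F g⁻¹ = -F g := by
    intro g
    have h1 := (hF g⁻¹).add (hF g)
    have h2 : Filter.Tendsto (fun n : ℕ => (D + |f 1|) / (n : ℝ)) Filter.atTop (nhds 0) :=
      tendsto_const_div_atTop_nhds_zero_nat _
    have h3 : F g⁻¹ + F g = 0 := by
      refine tendsto_nhds_unique h1 (squeeze_zero_norm (fun n => ?_) h2)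
      have h := hf (g⁻¹ ^ n) (g ^ n)
      rw [inv_pow, inv_mul_cancel] at h
      rw [← add_div, norm_div, Real.norm_eq_abs, Real.norm_eq_abs, Nat.abs_cast, inv_pow]
      gcongr
      have h' := abs_le.1 h
      have h4 := le_abs_self (f 1)
      have h5 := neg_abs_le (f 1)
      rw [abs_le]
      constructor <;> linarith
    linarith
  refine ⟨F, ⟨⟨4 * D, fun g h => ?_⟩, fun g n => ?_⟩, hnear⟩
  · have h1 := abs_le.1 (hnear g)
    have h2 := abs_le.1 (hnear h)
    have h3 := abs_le.1 (hnear (g * h))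
    have h4 := abs_le.1 (hf g h)
    rw [abs_le]
    constructor <;> linarith
  · obtain ⟨k, rfl | rfl⟩ := n.eq_nat_or_neg
    · simpa using hpow g k
    · rw [zpow_neg, hinv, zpow_natCast, hpow]
      push_cast
      ring

/-! ### From pseudocharacters to quasi-actions -/

/-- A quasimorphism twisted by a sign character acts on the line by isometries up to bounded
error. -/
lemma exists_cobounded_quasiAction {G : Type*} [Group G] (s : G → ℝ) (F : G → ℝ) (D : ℝ)
    (hs : ∀ g, |s g| = 1) (hmul : ∀ g h, s (g * h) = s g * s h)
    (hF : ∀ g h, |F (g * h) - F g - s g * F h| ≤ D)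
    (k : G) (hk : F k ≠ 0) (hsk : ∀ n : ℤ, s (k ^ n) = 1) (hFk : ∀ n : ℤ, F (k ^ n) = n * F k) :
    ∃ (K C : ℝ) (A : G → ℝ → ℝ), 1 ≤ K ∧ 0 ≤ C ∧ IsQuasiAction K C A ∧
      ∀ x : ℝ, ∃ C' : ℝ, 0 ≤ C' ∧ ∀ y : ℝ, ∃ g : G, dist (A g x) y ≤ C' := by
  have hD : 0 ≤ D := (abs_nonneg _).trans (hF 1 1)
  refine ⟨1, D, fun g x => s g * x + F g, le_rfl, hD, ⟨fun g => ⟨fun x y => ?_, fun y => ?_⟩,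
    fun g h x => ?_⟩, fun x => ⟨|F k|, abs_nonneg _, fun y => ?_⟩⟩
  · have e : dist (s g * x + F g) (s g * y + F g) = dist x y := by
      rw [dist_add_right, Real.dist_eq, ← mul_sub, abs_mul, hs, one_mul, Real.dist_eq]
    dsimp only
    rw [e]
    constructor <;> linarith
  · have hss : s g * s g = 1 := by rw [← abs_mul_abs_self, hs, one_mul]
    refine ⟨s g * (y - F g), ?_⟩
    dsimp only
    rw [← mul_assoc, hss]
    simpa using hD
  · dsimp only
    rw [dist_comm, Real.dist_eq, hmul]
    refine le_trans (le_of_eq ?_) (hF g h)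
    congr 1
    ring
  · refine ⟨k ^ ⌊(y - x) / F k⌋, ?_⟩
    dsimp only
    rw [hsk, hFk, dist_comm, Real.dist_eq]
    have e : y - (1 * x + ⌊(y - x) / F k⌋ * F k) = Int.fract ((y - x) / F k) * F k := by
      rw [← Int.self_sub_floor]
      field_simp
      ring
    rw [e, abs_mul, abs_of_nonneg (Int.fract_nonneg _)]
    exact mul_le_of_le_one_left (abs_nonneg _) (Int.fract_lt_one _).le

open Classical in
/-- A nontrivial pseudocharacter on an index two subgroup can be averaged, with a sign, over the
conjugation action of an element outside the subgroup, and then extends to the whole group. -/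
lemma exists_cobounded_quasiAction_of_index_two {G : Type*} [Group G] (H : Subgroup G)
    (hH : H.index = 2) (f : H → ℝ) (hf : IsPseudocharacter f) (hf0 : f ≠ 0) :
    ∃ (K C : ℝ) (A : G → ℝ → ℝ), 1 ≤ K ∧ 0 ≤ C ∧ IsQuasiAction K C A ∧
      ∀ x : ℝ, ∃ C' : ℝ, 0 ≤ C' ∧ ∀ y : ℝ, ∃ g : G, dist (A g x) y ≤ C' := by
  have hmem : ∀ a b : G, a * b ∈ H ↔ (a ∈ H ↔ b ∈ H) :=
    fun a b => Subgroup.mul_mem_iff_of_index_two hH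
  have hnormal : H.Normal := Subgroup.normal_of_index_eq_two hH
  obtain ⟨t, ht⟩ : ∃ t, t ∉ H := by
    by_contra! h
    rw [(Subgroup.eq_top_iff' H).2 h, Subgroup.index_top] at hH
    omega
  obtain ⟨⟨D, hD⟩, hpow⟩ := hf
  set p : G → ℝ := fun x => if h : x ∈ H then f ⟨x, h⟩ else 0 with hp
  have p_of : ∀ x : H, p x = f x := fun x => by simp [hp]
  have p_mul : ∀ a ∈ H, ∀ b ∈ H, |p (a * b) - p a - p b| ≤ D := by
    intro a ha b hb
    have h := hD ⟨a, ha⟩ ⟨b, hb⟩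
    simp only [← p_of] at h
    exact h
  have p_pow : ∀ a ∈ H, ∀ n : ℤ, p (a ^ n) = n * p a := by
    intro a ha n
    have h := hpow ⟨a, ha⟩ n
    simp only [← p_of] at h
    exact h
  have conj_mem : ∀ a ∈ H, t * a * t⁻¹ ∈ H := fun a ha => hnormal.conj_mem a ha t
  obtain ⟨k, hk⟩ := Function.ne_iff.1 hf0
  have hk : p k ≠ 0 := by rw [p_of]; exact hk
  obtain ⟨ε, hε, hkε⟩ : ∃ ε : ℝ, (ε = 1 ∨ ε = -1) ∧ p k + ε * p (t * k * t⁻¹) ≠ 0 := by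
    by_cases h : p k + 1 * p (t * k * t⁻¹) = 0
    · refine ⟨-1, Or.inr rfl, fun h' => hk ?_⟩
      linarith
    · exact ⟨1, Or.inl rfl, h⟩
  set q : G → ℝ := fun x => p x + ε * p (t * x * t⁻¹) with hq
  have q_mul : ∀ a ∈ H, ∀ b ∈ H, |q (a * b) - q a - q b| ≤ 2 * D := by
    intro a ha b hb
    have h1 := abs_le.1 (p_mul a ha b hb)
    have h2 := abs_le.1 (p_mul _ (conj_mem a ha) _ (conj_mem b hb))
    rw [show t * a * t⁻¹ * (t * b * t⁻¹) = t * (a * b) * t⁻¹ by group] at h2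
    simp only [hq]
    rw [abs_le]
    rcases hε with rfl | rfl <;> constructor <;> linarith
  have q_pow : ∀ a ∈ H, ∀ n : ℤ, q (a ^ n) = n * q a := by
    intro a ha n
    have h2 := p_pow _ (conj_mem a ha) n
    rw [conj_zpow] at h2
    simp only [hq]
    rw [h2, p_pow a ha]
    ring
  have htt : t * t ∈ H := by rw [hmem]
  set E : ℝ := 2 * D + |p (t * t)| + |p (t * t)⁻¹| with hE
  have q_conj : ∀ a ∈ H, |q (t * a * t⁻¹) - ε * q a| ≤ E := by
    intro a ha
    have h1 := abs_le.1 (p_mul _ htt a ha)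
    have h2 := abs_le.1 (p_mul _ (H.mul_mem htt ha) _ (H.inv_mem htt))
    rw [show t * t * a * (t * t)⁻¹ = t * (t * a * t⁻¹) * t⁻¹ by group] at h2
    have h3 := le_abs_self (p (t * t))
    have h4 := neg_abs_le (p (t * t))
    have h5 := le_abs_self (p (t * t)⁻¹)
    have h6 := neg_abs_le (p (t * t)⁻¹)
    simp only [hq]
    rw [abs_le]
    rcases hε with rfl | rfl <;> constructor <;> linarith
  have hε2 : ε * ε = 1 := by rcases hε with rfl | rfl <;> norm_num
  have hεabs : |ε| = 1 := by rcases hε with rfl | rfl <;> norm_num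
  have out_mem : ∀ g, g ∉ H → g * t⁻¹ ∈ H := by
    intro g hg
    rw [hmem, inv_mem_iff]
    tauto
  have hE0 : 0 ≤ E := (abs_nonneg _).trans (q_conj 1 H.one_mem)
  have hD0 : 0 ≤ D := (abs_nonneg _).trans (p_mul 1 H.one_mem 1 H.one_mem)
  have hk_mem : ∀ n : ℤ, (k : G) ^ n ∈ H := fun n => H.zpow_mem k.2 n
  refine exists_cobounded_quasiAction (fun g => if g ∈ H then 1 else ε)
    (fun g => if g ∈ H then q g else q (g * t⁻¹)) (4 * D + E + |q (t * t)|)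
    (fun g => ?_) (fun g h => ?_) (fun g h => ?_) k ?_ (fun n => ?_) (fun n => ?_)
  · split_ifs <;> simp [hεabs]
  · by_cases hg : g ∈ H <;> by_cases hh : h ∈ H <;> simp [hmem, hg, hh, hε2]
  · have hqt := abs_nonneg (q (t * t))
    by_cases hg : g ∈ H <;> by_cases hh : h ∈ H <;>
      simp only [hmem, hg, hh, if_true, if_false, iff_self, iff_true, iff_false, not_true_eq_false]
    · have h1 := q_mul g hg h hh
      rw [one_mul]
      linarith
    · have h1 := q_mul g hg _ (out_mem h hh)
      rw [one_mul, mul_assoc]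
      linarith
    · have h1 := abs_le.1 (q_mul _ (out_mem g hg) _ (conj_mem h hh))
      rw [show g * t⁻¹ * (t * h * t⁻¹) = g * h * t⁻¹ by group] at h1
      have h2 := abs_le.1 (q_conj h hh)
      rw [abs_le]
      constructor <;> linarith
    · have hm := conj_mem _ (out_mem h hh)
      have h1 := abs_le.1 (q_mul _ (out_mem g hg) _ (H.mul_mem hm htt))
      have h2 := abs_le.1 (q_mul _ hm _ htt)
      rw [show g * t⁻¹ * (t * (h * t⁻¹) * t⁻¹ * (t * t)) = g * h by group] at h1
      have h3 := abs_le.1 (q_conj _ (out_mem h hh))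
      have h4 := le_abs_self (q (t * t))
      have h5 := neg_abs_le (q (t * t))
      rw [abs_le]
      constructor <;> linarith
  · simpa using hkε
  · simp [hk_mem n]
  · simpa [hk_mem n] using q_pow k k.2 n

/-! ### Quasi-isometries of the line -/

/-- A property of points of a ray that is insensitive to moves of length at most one is constant. -/
lemma iff_of_forall_dist_le_one {a : ℝ} {P : ℝ → Prop}
    (hP : ∀ u v, a ≤ u → u ≤ v → v ≤ u + 1 → (P u ↔ P v)) {u v : ℝ} (hu : a ≤ u) (hv : a ≤ v) :
    P u ↔ P v := by
  have key : ∀ n : ℕ, ∀ u v, a ≤ u → u ≤ v → v ≤ u + n → (P u ↔ P v) := by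
    intro n
    induction n with
    | zero =>
      intro u v _ h1 h2
      rw [le_antisymm h1 (by simpa using h2)]
    | succ n ih =>
      intro u v hu h1 h2
      push_cast at h2
      by_cases h : v ≤ u + 1
      · exact hP u v hu h1 h
      · exact (hP u (u + 1) hu (by linarith) le_rfl).trans
          (ih (u + 1) v (by linarith) (by linarith) (by linarith))
  have key' : ∀ u v, a ≤ u → u ≤ v → (P u ↔ P v) := by
    intro u v hu h
    obtain ⟨n, hn⟩ := exists_nat_ge (v - u)
    exact key n u v hu h (by linarith)
  rcases le_total u v with h | h
  · exact key' u v hu h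
  · exact (key' v u hv h).symm

/-- A quasi-isometric embedding of the line into itself is coarsely monotone. -/
lemma coarse_monotone_or_antitone {K C : ℝ} (hK : 1 ≤ K) (hC : 0 ≤ C) {q : ℝ → ℝ}
    (hq : ∀ x y : ℝ, |x - y| / K - C ≤ |q x - q y| ∧ |q x - q y| ≤ K * |x - y| + C) :
    (∀ x y, x + K * (K + 2 * C + 1) ≤ y → (y - x) / K - C ≤ q y - q x) ∨
      ∀ x y, x + K * (K + 2 * C + 1) ≤ y → (y - x) / K - C ≤ q x - q y := by
  set T := K * (K + 2 * C + 1) with hT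
  have hK0 : 0 < K := by linarith
  have hT0 : 0 ≤ T := by positivity
  have hbig : ∀ x y, x + T ≤ y → K + C + 1 ≤ (y - x) / K - C ∧ (y - x) / K - C ≤ |q y - q x| := by
    intro x y h
    have h1 := (hq y x).1
    rw [abs_of_nonneg (by linarith : 0 ≤ y - x)] at h1
    refine ⟨?_, h1⟩
    rw [le_sub_iff_add_le, le_div_iff₀ hK0]
    linarith
  have hsmall : ∀ x y, x ≤ y → y ≤ x + 1 → |q x - q y| ≤ K + C := by
    intro x y h1 h2
    have h3 := (hq x y).2
    have h4 : |x - y| ≤ 1 := by rw [abs_le]; constructor <;> linarith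
    nlinarith
  have hright : ∀ x y y', x + T ≤ y → x + T ≤ y' → (q x < q y ↔ q x < q y') := by
    intro x y y' h h'
    refine iff_of_forall_dist_le_one (a := x + T) (P := fun y => q x < q y) ?_ h h'
    intro u v hu h1 h2
    have h3 := hbig x u hu
    have h4 := hbig x v (by linarith)
    have h5 := abs_le.1 (hsmall u v h1 h2)
    constructor <;> intro h6 <;> by_contra h7
    · rw [abs_of_nonpos (by linarith : q v - q x ≤ 0)] at h4
      linarith
    · rw [abs_of_nonpos (by linarith : q u - q x ≤ 0)] at h3
      linarith
  have hleft : ∀ y x x', x + T ≤ y → x' + T ≤ y → (q x < q y ↔ q x' < q y) := by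
    intro y x x' h h'
    have := iff_of_forall_dist_le_one (a := -(y - T)) (P := fun z => q (-z) < q y) ?_
      (by linarith : -(y - T) ≤ -x) (by linarith : -(y - T) ≤ -x')
    · simpa only [neg_neg] using this
    intro u v hu h1 h2
    have h3 := hbig (-u) y (by linarith)
    have h4 := hbig (-v) y (by linarith)
    have h5 := abs_le.1 (hsmall (-v) (-u) (by linarith) (by linarith))
    constructor <;> intro h6 <;> by_contra h7
    · rw [abs_of_nonpos (by linarith : q y - q (-v) ≤ 0)] at h4
      linarith
    · rw [abs_of_nonpos (by linarith : q y - q (-u) ≤ 0)] at h3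
      linarith
  have hconst : ∀ x y, x + T ≤ y → (q x < q y ↔ q 0 < q T) := by
    intro x y h
    have h1 := hright x y (max y T) h (h.trans (le_max_left _ _))
    have h2 := hleft (max y T) x 0 (h.trans (le_max_left _ _))
      (by rw [zero_add]; exact le_max_right _ _)
    have h3 := hright 0 (max y T) T (by rw [zero_add]; exact le_max_right _ _) (by rw [zero_add])
    exact h1.trans (h2.trans h3)
  by_cases h0 : q 0 < q T
  · left
    intro x y h
    have h1 := (hconst x y h).2 h0
    have h2 := (hbig x y h).2
    rwa [abs_of_pos (by linarith)] at h2
  · right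
    intro x y h
    have h1 := mt (hconst x y h).1 h0
    have h2 := (hbig x y h).2
    rw [abs_of_nonpos (by linarith)] at h2
    linarith

/-! ### Word length along a coarse line -/

/-- The least number of elements of `S` needed to write `g` as a product. -/
noncomputable def wordNorm {G : Type*} [Group G] (S : Set G) (g : G) : ℕ :=
  sInf {n | ∃ l : List G, (∀ s ∈ l, s ∈ S) ∧ l.length = n ∧ l.prod = g}

lemma wordNorm_prod_le {G : Type*} [Group G] {S : Set G} {l : List G} (hl : ∀ s ∈ l, s ∈ S) :
    wordNorm S l.prod ≤ l.length :=
  Nat.sInf_le ⟨l, hl, rfl, rfl⟩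

section CoarseLine

variable {G : Type*} [Group G] {S : Set G}

lemma exists_list_length_eq_wordNorm (hgen : ∀ g, ∃ l : List G, (∀ s ∈ l, s ∈ S) ∧ l.prod = g)
    (g : G) : ∃ l : List G, (∀ s ∈ l, s ∈ S) ∧ l.length = wordNorm S g ∧ l.prod = g := by
  obtain ⟨l, hl, h⟩ := hgen g
  exact Nat.sInf_mem (s := {n | ∃ l : List G, (∀ s ∈ l, s ∈ S) ∧ l.length = n ∧ l.prod = g})
    ⟨l.length, l, hl, rfl, h⟩

lemma wordNorm_mul_le (hgen : ∀ g, ∃ l : List G, (∀ s ∈ l, s ∈ S) ∧ l.prod = g) (g h : G) :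
    wordNorm S (g * h) ≤ wordNorm S g + wordNorm S h := by
  obtain ⟨l, hl, hn, rfl⟩ := exists_list_length_eq_wordNorm hgen g
  obtain ⟨m, hm, hk, rfl⟩ := exists_list_length_eq_wordNorm hgen h
  rw [← hn, ← hk, ← List.prod_append, ← List.length_append]
  refine wordNorm_prod_le fun s hs => ?_
  rcases List.mem_append.1 hs with h | h
  · exact hl s h
  · exact hm s h

lemma wordNorm_inv (hgen : ∀ g, ∃ l : List G, (∀ s ∈ l, s ∈ S) ∧ l.prod = g)
    (hS : ∀ s ∈ S, s⁻¹ ∈ S) (g : G) : wordNorm S g⁻¹ = wordNorm S g := by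
  have key : ∀ g, wordNorm S g⁻¹ ≤ wordNorm S g := by
    intro g
    obtain ⟨l, hl, hn, rfl⟩ := exists_list_length_eq_wordNorm hgen g
    rw [← hn, List.prod_inv_reverse]
    refine (wordNorm_prod_le fun s hs => ?_).trans (by simp)
    simp only [List.mem_reverse, List.mem_map] at hs
    obtain ⟨a, ha, rfl⟩ := hs
    exact hS a (hl a ha)
  exact le_antisymm (key g) (by simpa using key g⁻¹)

variable {φ : G → ℝ} {J : ℝ}

lemma abs_sub_le_mul_wordNorm (hgen : ∀ g, ∃ l : List G, (∀ s ∈ l, s ∈ S) ∧ l.prod = g)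
    (hJ : ∀ x, ∀ s ∈ S, |φ (x * s) - φ x| ≤ J) (g : G) :
    |φ g - φ 1| ≤ J * wordNorm S g := by
  have key : ∀ (l : List G) (x : G), (∀ s ∈ l, s ∈ S) → |φ (x * l.prod) - φ x| ≤ J * l.length := by
    intro l
    induction l with
    | nil => simp
    | cons s l ih =>
      intro x hl
      have h1 := abs_le.1 (ih (x * s) fun a ha => hl a (List.mem_cons_of_mem _ ha))
      have h2 := abs_le.1 (hJ x s (hl s List.mem_cons_self))
      rw [mul_assoc, ← List.prod_cons] at h1
      rw [List.length_cons, abs_le]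
      push_cast
      constructor <;> linarith
  obtain ⟨l, hl, hn, rfl⟩ := exists_list_length_eq_wordNorm hgen g
  simpa [hn] using key l 1 hl

/-- A path with jumps at most `J` passes within `J` of every intermediate value. -/
lemma exists_append_abs_sub_le (hJ0 : 0 ≤ J) (hJ : ∀ x, ∀ s ∈ S, |φ (x * s) - φ x| ≤ J) {c : ℝ}
    (l : List G) : ∀ x : G, (∀ s ∈ l, s ∈ S) → φ x ≤ c → c ≤ φ (x * l.prod) →
      ∃ l₁ l₂ : List G, l = l₁ ++ l₂ ∧ |φ (x * l₁.prod) - c| ≤ J := by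
  induction l with
  | nil =>
    intro x _ h1 h2
    refine ⟨[], [], rfl, ?_⟩
    simp only [List.prod_nil, mul_one] at h2 ⊢
    rwa [le_antisymm h1 h2, sub_self, abs_zero]
  | cons s l ih =>
    intro x hl h1 h2
    by_cases h : φ (x * s) ≤ c
    · obtain ⟨l₁, l₂, rfl, h3⟩ := ih (x * s) (fun a ha => hl a (List.mem_cons_of_mem _ ha)) h
        (by rwa [mul_assoc, ← List.prod_cons])
      exact ⟨s :: l₁, l₂, rfl, by rwa [List.prod_cons, ← mul_assoc]⟩
    · have h3 := abs_le.1 (hJ x s (hl s List.mem_cons_self))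
      refine ⟨[], s :: l, rfl, ?_⟩
      rw [List.prod_nil, mul_one, abs_le]
      constructor <;> linarith

/-- If nearby values of `φ` come from points at bounded word distance, word distances are coarsely
additive along `φ`. -/
lemma exists_wordNorm_add_le (hgen : ∀ g, ∃ l : List G, (∀ s ∈ l, s ∈ S) ∧ l.prod = g)
    (hS : ∀ s ∈ S, s⁻¹ ∈ S) (hJ0 : 0 ≤ J) (hJ : ∀ x, ∀ s ∈ S, |φ (x * s) - φ x| ≤ J)
    (hN : ∀ r : ℝ, ∃ N : ℕ, ∀ x y, |φ x - φ y| ≤ r → wordNorm S (x⁻¹ * y) ≤ N) :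
    ∃ M : ℕ, ∀ x y z, φ x ≤ φ y → φ y ≤ φ z →
      wordNorm S (x⁻¹ * y) + wordNorm S (y⁻¹ * z) ≤ wordNorm S (x⁻¹ * z) + M := by
  obtain ⟨N, hN⟩ := hN J
  refine ⟨2 * N, fun x y z hxy hyz => ?_⟩
  obtain ⟨l, hl, hn, hz⟩ := exists_list_length_eq_wordNorm hgen (x⁻¹ * z)
  have hz' : z = x * l.prod := by rw [hz, mul_inv_cancel_left]
  obtain ⟨l₁, l₂, rfl, h⟩ := exists_append_abs_sub_le hJ0 hJ l x hl hxy (by rwa [← hz'])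
  have h1 := hN _ _ h
  have h2 := wordNorm_inv hgen hS ((x * l₁.prod)⁻¹ * y)
  have h3 := wordNorm_prod_le fun s hs => hl s (List.mem_append_left l₂ hs)
  have h4 := wordNorm_prod_le fun s hs => hl s (List.mem_append_right l₁ hs)
  have h5 := wordNorm_mul_le hgen l₁.prod ((x * l₁.prod)⁻¹ * y)
  have h6 := wordNorm_mul_le hgen ((x * l₁.prod)⁻¹ * y)⁻¹ l₂.prod
  rw [show l₁.prod * ((x * l₁.prod)⁻¹ * y) = x⁻¹ * y by group] at h5
  rw [show ((x * l₁.prod)⁻¹ * y)⁻¹ * l₂.prod = y⁻¹ * z by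
    rw [hz', List.prod_append]; group] at h6
  rw [List.length_append] at hn
  omega

/-- Word length, signed according to the side of the identity, is a coarse coordinate on the
group. -/
lemma exists_signed_wordNorm (hgen : ∀ g, ∃ l : List G, (∀ s ∈ l, s ∈ S) ∧ l.prod = g)
    (hS : ∀ s ∈ S, s⁻¹ ∈ S) (hJ0 : 0 ≤ J) (hJ : ∀ x, ∀ s ∈ S, |φ (x * s) - φ x| ≤ J)
    (hN : ∀ r : ℝ, ∃ N : ℕ, ∀ x y, |φ x - φ y| ≤ r → wordNorm S (x⁻¹ * y) ≤ N) :
    ∃ (b : G → ℝ) (M : ℝ), (∀ x, φ 1 ≤ φ x → b x = wordNorm S x) ∧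
      (∀ x, φ x ≤ φ 1 → |b x + wordNorm S x| ≤ M) ∧
      ∀ x y, φ x ≤ φ y → |b y - b x - wordNorm S (x⁻¹ * y)| ≤ M := by
  classical
  obtain ⟨M, hM⟩ := exists_wordNorm_add_le hgen hS hJ0 hJ hN
  obtain ⟨N, hN⟩ := hN 0
  have htri : ∀ x y z : G,
      wordNorm S (x⁻¹ * z) ≤ wordNorm S (x⁻¹ * y) + wordNorm S (y⁻¹ * z) := by
    intro x y z
    have h := wordNorm_mul_le hgen (x⁻¹ * y) (y⁻¹ * z)
    rwa [show x⁻¹ * y * (y⁻¹ * z) = x⁻¹ * z by group] at h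
  refine ⟨fun x => if φ 1 ≤ φ x then wordNorm S x else -wordNorm S x, M + 2 * N,
    fun x hx => if_pos hx, fun x hx => ?_, fun x y hxy => ?_⟩
  · dsimp only
    split_ifs with h
    · have h1 := hN 1 x (by rw [le_antisymm h hx, sub_self, abs_zero])
      rw [inv_one, one_mul] at h1
      have h2 : (wordNorm S x : ℝ) ≤ N := by exact_mod_cast h1
      rw [abs_of_nonneg (by positivity)]
      have h3 : (0 : ℝ) ≤ M := by positivity
      linarith
    · rw [neg_add_cancel, abs_zero]
      positivity
  · have hx := wordNorm_inv hgen hS x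
    have hy := wordNorm_inv hgen hS y
    have hN0 : (0 : ℝ) ≤ N := by positivity
    dsimp only
    by_cases h1 : φ 1 ≤ φ x
    · rw [if_pos h1, if_pos (h1.trans hxy)]
      have h2 := hM 1 x y h1 hxy
      have h3 := htri 1 x y
      rw [inv_one, one_mul, one_mul] at h2 h3
      rify at h2 h3
      rw [abs_le]
      constructor <;> linarith
    · rw [not_le] at h1
      by_cases h2 : φ 1 ≤ φ y
      · rw [if_neg h1.not_ge, if_pos h2]
        have h3 := hM x 1 y h1.le h2
        have h4 := htri x 1 y
        rw [inv_one, one_mul, mul_one, hx] at h3 h4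
        rify at h3 h4
        rw [abs_le]
        constructor <;> linarith
      · rw [if_neg h1.not_ge, if_neg h2]
        have h3 := hM x y 1 hxy (not_le.1 h2).le
        have h4 := htri x y 1
        rw [mul_one, mul_one, hx, hy] at h3 h4
        rify at h3 h4
        rw [abs_le]
        constructor <;> linarith

/-- The signed word length is a quasimorphism on elements coarsely preserving the order. -/
lemma exists_quasimorphism_of_coarse_order
    (hgen : ∀ g, ∃ l : List G, (∀ s ∈ l, s ∈ S) ∧ l.prod = g)
    (hS : ∀ s ∈ S, s⁻¹ ∈ S) (hJ0 : 0 ≤ J) (hJ : ∀ x, ∀ s ∈ S, |φ (x * s) - φ x| ≤ J)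
    (hN : ∀ r : ℝ, ∃ N : ℕ, ∀ x y, |φ x - φ y| ≤ r → wordNorm S (x⁻¹ * y) ≤ N)
    (H : Subgroup G) (T : ℝ)
    (hup : ∀ g ∈ H, ∀ h, φ 1 + T ≤ φ h → φ g ≤ φ (g * h))
    (hdown : ∀ g ∈ H, ∀ h, φ h + T ≤ φ 1 → φ (g * h) ≤ φ g) :
    ∃ (b : G → ℝ) (D L : ℝ), (∀ g ∈ H, ∀ h, |b (g * h) - b g - b h| ≤ D) ∧
      ∀ g, |φ g - φ 1| ≤ J * |b g| + L := by
  obtain ⟨b, M, hb1, hb2, hb3⟩ := exists_signed_wordNorm hgen hS hJ0 hJ hN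
  obtain ⟨N, hN⟩ := hN |T|
  have hM0 : 0 ≤ M := (abs_nonneg _).trans (hb3 1 1 le_rfl)
  have hN0 : (0 : ℝ) ≤ N := by positivity
  have hb : ∀ x, |(|b x| - wordNorm S x)| ≤ M := by
    intro x
    rcases le_total (φ 1) (φ x) with h | h
    · rw [hb1 x h, Nat.abs_cast, sub_self, abs_zero]
      exact hM0
    · have h1 := hb2 x h
      have h2 := abs_abs_sub_abs_le_abs_sub (b x) (-wordNorm S x)
      rw [abs_neg, Nat.abs_cast, sub_neg_eq_add] at h2
      exact h2.trans h1
  have hinv := wordNorm_inv hgen hS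
  refine ⟨b, 2 * M + 2 * N, J * M, fun g hg h => ?_, fun g => ?_⟩
  · by_cases h1 : φ 1 + |T| ≤ φ h
    · have h2 := hb3 _ _ (hup g hg h (by linarith [le_abs_self T]))
      rw [inv_mul_cancel_left, ← hb1 h (by linarith [abs_nonneg T])] at h2
      linarith
    by_cases h2 : φ h + |T| ≤ φ 1
    · have h3 := abs_le.1 (hb3 _ _ (hdown g hg h (by linarith [le_abs_self T])))
      rw [mul_inv_rev, inv_mul_cancel_right, hinv] at h3
      have h4 := abs_le.1 (hb2 h (by linarith [abs_nonneg T]))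
      rw [abs_le]
      constructor <;> linarith
    have h3 := hN 1 h (by rw [abs_le]; constructor <;> linarith)
    rw [inv_one, one_mul] at h3
    rify at h3
    have h4 := abs_le.1 (hb h)
    have h5 := le_abs_self (b h)
    have h6 := neg_abs_le (b h)
    have h0 : (0 : ℝ) ≤ wordNorm S h := by positivity
    rcases le_total (φ g) (φ (g * h)) with h7 | h7
    · have h8 := abs_le.1 (hb3 _ _ h7)
      rw [inv_mul_cancel_left] at h8
      rw [abs_le]
      constructor <;> linarith
    · have h8 := abs_le.1 (hb3 _ _ h7)
      rw [mul_inv_rev, inv_mul_cancel_right, hinv] at h8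
      rw [abs_le]
      constructor <;> linarith
  · have h1 := abs_sub_le_mul_wordNorm hgen hJ g
    have h2 := (abs_le.1 (hb g)).1
    nlinarith

end CoarseLine

/-! ### From quasi-actions to pseudocharacters -/

section QuasiAction

variable {G : Type*} [Group G] {K C : ℝ} {A : G → ℝ → ℝ}

lemma IsQuasiAction.abs_bounds (hA : IsQuasiAction K C A) (g : G) (x y : ℝ) :
    |x - y| / K - C ≤ |A g x - A g y| ∧ |A g x - A g y| ≤ K * |x - y| + C :=
  (hA.1 g).1 x y

lemma IsQuasiAction.abs_comp_sub_le (hA : IsQuasiAction K C A) (g h : G) (x : ℝ) :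
    |A g (A h x) - A (g * h) x| ≤ C :=
  hA.2 g h x

lemma IsQuasiAction.abs_one_sub_le (hK : 1 ≤ K) (hA : IsQuasiAction K C A) (x : ℝ) :
    |A 1 x - x| ≤ K * C + 3 * C := by
  obtain ⟨y, hy⟩ := (hA.1 1).2 x
  rw [Real.dist_eq] at hy
  have h1 := abs_le.1 (hA.abs_bounds 1 x (A 1 y)).2
  have h2 := abs_le.1 (hA.abs_comp_sub_le 1 1 y)
  have h3 : K * |x - A 1 y| ≤ K * C := by gcongr
  rw [mul_one] at h2
  have h4 := abs_le.1 hy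
  rw [abs_le]
  constructor <;> linarith

/-- A quasi-action on the line has a sign character recording which elements coarsely reverse the
line. -/
lemma IsQuasiAction.exists_orientation (hK : 1 ≤ K) (hC : 0 ≤ C) (hA : IsQuasiAction K C A) :
    ∃ o : G →* ℤˣ, ∀ g, o g = 1 → ∀ x y, x + K * (K + 2 * C + 1) ≤ y →
      (y - x) / K - C ≤ A g y - A g x := by
  set T := K * (K + 2 * C + 1) with hT
  have hK0 : 0 < K := by linarith
  have hT0 : 0 ≤ T := by positivity
  have hdich : ∀ g, ∃ o : ℤˣ, ∀ x y, x + T ≤ y →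
      (y - x) / K - C ≤ ((o : ℤ) : ℝ) * (A g y - A g x) := by
    intro g
    rcases coarse_monotone_or_antitone hK hC (hA.abs_bounds g) with h | h
    · exact ⟨1, by simpa using h⟩
    · exact ⟨-1, by simpa using h⟩
  choose o ho using hdich
  have hcases : ∀ g, o g = 1 ∨ o g = -1 := fun g => Int.units_eq_one_or (o g)
  have hmul : ∀ g h, o (g * h) = o g * o h := by
    intro g h
    set U := T + K * (3 * C + 1) with hU
    set V := K * (U + C) with hV
    have hU1 : U ≤ (V + T - 0) / K - C := by
      rw [le_sub_iff_add_le, le_div_iff₀ hK0]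
      linarith
    have hU0 : T ≤ U := by
      have : 0 ≤ K * (3 * C + 1) := by positivity
      linarith
    have hV0 : 0 ≤ V := by
      have : 0 ≤ U := by linarith
      positivity
    have hdiv : ∀ d, U ≤ d → 3 * C + 1 ≤ d / K := by
      intro d hd
      rw [le_div_iff₀ hK0]
      linarith
    have h1 := ho h 0 (V + T) (by linarith)
    have h2 := ho (g * h) 0 (V + T) (by linarith)
    have h3 := abs_le.1 (hA.abs_comp_sub_le g h 0)
    have h4 := abs_le.1 (hA.abs_comp_sub_le g h (V + T))
    have h5 : U ≤ ((o h : ℤ) : ℝ) * (A h (V + T) - A h 0) := hU1.trans h1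
    have h6 : 2 * C + 1 ≤
        ((o g : ℤ) : ℝ) * ((o h : ℤ) : ℝ) * (A g (A h (V + T)) - A g (A h 0)) := by
      rcases hcases h with hh | hh
      · simp only [hh, Units.val_one, Int.cast_one, one_mul, mul_one] at h5 ⊢
        have h7 := ho g (A h 0) (A h (V + T)) (by linarith)
        have h8 := hdiv _ h5
        linarith
      · simp only [hh, Units.val_neg, Units.val_one, Int.cast_neg, Int.cast_one, neg_mul,
          one_mul, neg_sub, mul_neg, mul_one] at h5 ⊢
        have h7 := ho g (A h (V + T)) (A h 0) (by linarith)
        have h8 := hdiv _ h5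
        linarith
    have h10 : 0 < ((o (g * h) : ℤ) : ℝ) * (A (g * h) (V + T) - A (g * h) 0) := by
      have h12 := hdiv (V + T - 0) (by nlinarith)
      linarith
    rcases hcases g with hg | hg <;> rcases hcases h with hh | hh <;>
      rcases hcases (g * h) with hgh | hgh <;>
      simp only [hg, hh, hgh, Units.val_neg, Units.val_one, Int.cast_neg, Int.cast_one] at h6 h10 ⊢ <;>
      first
      | (exfalso; linarith)
      | simp
  refine ⟨MonoidHom.mk' o hmul, fun g hg x y hxy => ?_⟩
  have h := ho g x y hxy
  rw [MonoidHom.mk'_apply] at hg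
  simpa [hg] using h

lemma IsQuasiAction.abs_inv_mul_le (hK : 1 ≤ K) (hA : IsQuasiAction K C A) {r : ℝ} {x y : G}
    (h : |A x 0 - A y 0| ≤ r) : |A (x⁻¹ * y) 0| ≤ K * r + (K * C + 6 * C) := by
  have h1 := abs_le.1 (hA.abs_comp_sub_le x⁻¹ y 0)
  have h2 := abs_le.1 (hA.abs_comp_sub_le x⁻¹ x 0)
  have h3 := abs_le.1 (hA.abs_bounds x⁻¹ (A x 0) (A y 0)).2
  have h4 := abs_le.1 (hA.abs_one_sub_le hK 0)
  have h5 : K * |A x 0 - A y 0| ≤ K * r := by gcongr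
  rw [inv_mul_cancel] at h2
  rw [abs_le]
  constructor <;> linarith

/-- Elements whose orbit points are close differ by a bounded product of elements moving the
basepoint a bounded distance. -/
lemma exists_list_of_abs_sub_le {φ : G → ℝ} {S : Set G} {B : ℝ} (hB : 0 ≤ B)
    (hφ : ∀ y : ℝ, ∃ g, |φ g - y| ≤ B)
    (hS : ∀ x y, |φ x - φ y| ≤ 2 * B + 1 → x⁻¹ * y ∈ S) (n : ℕ) :
    ∀ x y, |φ x - φ y| ≤ n + (B + 1) →
      ∃ l : List G, (∀ s ∈ l, s ∈ S) ∧ l.length ≤ n + 1 ∧ l.prod = x⁻¹ * y := by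
  induction n with
  | zero =>
    intro x y h
    refine ⟨[x⁻¹ * y], ?_, by simp, by simp⟩
    push_cast at h
    simpa using hS x y (by linarith)
  | succ n ih =>
    intro x y h
    push_cast at h
    have hw : ∃ w, |φ x - φ w| ≤ n + (B + 1) ∧ |φ w - φ y| ≤ 2 * B + 1 := by
      by_cases hle : |φ x - φ y| ≤ n + (B + 1)
      · exact ⟨y, hle, by rw [sub_self, abs_zero]; linarith⟩
      have hn : (0 : ℝ) ≤ n := by positivity
      rcases le_total (φ x) (φ y) with hxy | hxy
      · obtain ⟨w, hw⟩ := hφ (φ y - (B + 1))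
        refine ⟨w, ?_⟩
        rw [abs_of_nonpos (by linarith)] at h hle
        have hw := abs_le.1 hw
        refine ⟨abs_le.2 ⟨?_, ?_⟩, abs_le.2 ⟨?_, ?_⟩⟩ <;> linarith
      · obtain ⟨w, hw⟩ := hφ (φ y + (B + 1))
        refine ⟨w, ?_⟩
        rw [abs_of_nonneg (by linarith)] at h hle
        have hw := abs_le.1 hw
        refine ⟨abs_le.2 ⟨?_, ?_⟩, abs_le.2 ⟨?_, ?_⟩⟩ <;> linarith
    obtain ⟨w, h1, h2⟩ := hw
    obtain ⟨l, hl, hn, hp⟩ := ih x w h1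
    refine ⟨l ++ [w⁻¹ * y], ?_, by simpa using hn, ?_⟩
    · intro s hs
      rcases List.mem_append.1 hs with h | h
      · exact hl s h
      · rw [List.mem_singleton.1 h]
        exact hS w y h2
    · rw [List.prod_append, List.prod_singleton, hp]
      group

/-- Subgroups of index at most two have unbounded orbits under a cobounded quasi-action. -/
lemma IsQuasiAction.exists_lt_abs_of_index_le_two (hC : 0 ≤ C) (hK : 1 ≤ K)
    (hA : IsQuasiAction K C A) (H : Subgroup G) (hH : H.index = 1 ∨ H.index = 2) {B : ℝ}
    (hB : ∀ y : ℝ, ∃ g, |A g 0 - y| ≤ B) (L : ℝ) : ∃ h ∈ H, L < |A h 0| := by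
  by_contra! hL
  obtain ⟨t, ht⟩ : ∃ t : G, ∀ g, g ∉ H → t⁻¹ * g ∈ H := by
    rcases hH with hH | hH
    · rw [Subgroup.index_eq_one] at hH
      exact ⟨1, by simp [hH]⟩
    · by_cases h : ∃ t, t ∉ H
      · obtain ⟨t, ht⟩ := h
        refine ⟨t, fun g hg => ?_⟩
        rw [Subgroup.mul_mem_iff_of_index_two hH, inv_mem_iff]
        tauto
      · push Not at h
        exact ⟨1, fun g hg => absurd (h g) hg⟩
  have hL0 : 0 ≤ L := (abs_nonneg _).trans (hL 1 H.one_mem)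
  have hbd : ∀ g, |A g 0| ≤ L + |A t 0| + K * L + 2 * C := by
    intro g
    have h0 := abs_nonneg (A t 0)
    have hKL : 0 ≤ K * L := by positivity
    by_cases hg : g ∈ H
    · have := hL g hg
      linarith
    · have h1 := hL _ (ht g hg)
      have h2 := abs_le.1 (hA.abs_comp_sub_le t (t⁻¹ * g) 0)
      have h3 := abs_le.1 (hA.abs_bounds t (A (t⁻¹ * g) 0) 0).2
      have h4 : K * |A (t⁻¹ * g) 0 - 0| ≤ K * L := by
        rw [sub_zero]
        gcongr
      rw [mul_inv_cancel_left] at h2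
      have h5 := le_abs_self (A t 0)
      have h6 := neg_abs_le (A t 0)
      rw [abs_le]
      constructor <;> linarith
  obtain ⟨g, hg⟩ := hB (L + |A t 0| + K * L + 2 * C + B + 1)
  have h1 := abs_le.1 (hbd g)
  have h2 := abs_le.1 hg
  linarith

/-- A cobounded quasi-action on the line yields a pseudocharacter on its orientation-preserving
subgroup. -/
lemma IsQuasiAction.exists_pseudocharacter (hK : 1 ≤ K) (hC : 0 ≤ C) (hA : IsQuasiAction K C A)
    {B : ℝ} (hB0 : 0 ≤ B) (hB : ∀ y : ℝ, ∃ g, |A g 0 - y| ≤ B) :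
    ∃ H : Subgroup G, (H.index = 1 ∨ H.index = 2) ∧
      ∃ f : H → ℝ, IsPseudocharacter f ∧ f ≠ 0 := by
  obtain ⟨o, ho⟩ := hA.exists_orientation hK hC
  have hK0 : 0 < K := by linarith
  have hindex : o.ker.index = 1 ∨ o.ker.index = 2 := by
    rw [Subgroup.index_ker]
    have h : Nat.card o.range ∣ 2 := by
      have := Subgroup.card_subgroup_dvd_card o.range
      rwa [Nat.card_eq_fintype_card (α := ℤˣ), Fintype.card_units_int] at this
    exact (Nat.dvd_prime Nat.prime_two).1 h
  refine ⟨o.ker, hindex, ?_⟩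
  set R : ℝ := K * (2 * B + 1) + (K * C + 6 * C) with hR
  have hR0 : 0 ≤ R := by positivity
  set S : Set G := {s | |A s 0| ≤ R ∧ |A s⁻¹ 0| ≤ R} with hSdef
  have hS : ∀ s ∈ S, s⁻¹ ∈ S := fun s hs => ⟨hs.2, by rw [inv_inv]; exact hs.1⟩
  have hSmem : ∀ x y, |A x 0 - A y 0| ≤ 2 * B + 1 → x⁻¹ * y ∈ S := by
    intro x y h
    refine ⟨hA.abs_inv_mul_le hK h, ?_⟩
    rw [mul_inv_rev, inv_inv]
    exact hA.abs_inv_mul_le hK (by rwa [abs_sub_comm])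
  have hlist := exists_list_of_abs_sub_le (φ := fun g => A g 0) hB0 hB hSmem
  have hgen : ∀ g, ∃ l : List G, (∀ s ∈ l, s ∈ S) ∧ l.prod = g := by
    intro g
    obtain ⟨n, hn⟩ := exists_nat_ge |A 1 0 - A g 0|
    obtain ⟨l, hl, -, h⟩ := hlist n 1 g (by linarith)
    exact ⟨l, hl, by simpa using h⟩
  have hJ : ∀ x, ∀ s ∈ S, |A (x * s) 0 - A x 0| ≤ K * R + 2 * C := by
    intro x s hs
    have h1 := abs_le.1 (hA.abs_comp_sub_le x s 0)
    have h2 := abs_le.1 (hA.abs_bounds x (A s 0) 0).2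
    have h3 : K * |A s 0 - 0| ≤ K * R := by
      rw [sub_zero]
      gcongr
      exact hs.1
    rw [abs_le]
    constructor <;> linarith
  have hN : ∀ r : ℝ, ∃ N : ℕ, ∀ x y, |A x 0 - A y 0| ≤ r → wordNorm S (x⁻¹ * y) ≤ N := by
    intro r
    obtain ⟨n, hn⟩ := exists_nat_ge r
    refine ⟨n + 1, fun x y h => ?_⟩
    obtain ⟨l, hl, hle, h⟩ := hlist n x y (by linarith)
    rw [← h]
    exact (wordNorm_prod_le hl).trans hle
  have hone := abs_le.1 (hA.abs_one_sub_le hK 0)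
  set T := K * (K + 2 * C + 1) + (K * C + 3 * C) + K * (2 * C) with hT
  have hT1 : 0 ≤ K * (K + 2 * C + 1) := by positivity
  have hT2 : 0 ≤ K * (2 * C) := by positivity
  have hdiv : ∀ d, K * (2 * C) ≤ d → 2 * C ≤ d / K := by
    intro d hd
    rw [le_div_iff₀ hK0]
    linarith
  obtain ⟨b, D, L, hb, hbL⟩ := exists_quasimorphism_of_coarse_order (φ := fun g => A g 0) hgen hS
    (by positivity) hJ hN o.ker T
    (fun g hg h hle => by
      have h1 := ho g hg 0 (A h 0) (by linarith)
      have h2 := hdiv (A h 0 - 0) (by linarith)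
      have h3 := abs_le.1 (hA.abs_comp_sub_le g h 0)
      linarith)
    (fun g hg h hle => by
      have h1 := ho g hg (A h 0) 0 (by linarith)
      have h2 := hdiv (0 - A h 0) (by linarith)
      have h3 := abs_le.1 (hA.abs_comp_sub_le g h 0)
      linarith)
  obtain ⟨F, hF, hFb⟩ := exists_pseudocharacter_near (f := fun h : o.ker => b h) (D := D)
    (fun g h => hb g g.2 h)
  refine ⟨F, hF, ?_⟩
  rintro rfl
  obtain ⟨h, hh, hlt⟩ := hA.exists_lt_abs_of_index_le_two hC hK o.ker hindex hB
    ((K * R + 2 * C) * D + L + |A 1 0|)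
  have h1 := hFb ⟨h, hh⟩
  have h2 := hbL h
  rw [Pi.zero_apply, zero_sub, abs_neg] at h1
  have h3 : (K * R + 2 * C) * |b h| ≤ (K * R + 2 * C) * D := by gcongr
  have h4 := abs_sub_abs_le_abs_sub (A h 0) (A 1 0)
  linarith

end QuasiAction

/-- a finitely generated group admits a cobounded quasi-action on ℝ if and
only if some subgroup of index at most 2 admits a nontrivial pseudocharacter. -/
theorem stmt_13 (G : Type) [Group G] (hFG : Group.FG G) :
    (∃ (K C : ℝ) (A : G → ℝ → ℝ), 1 ≤ K ∧ 0 ≤ C ∧ IsQuasiAction K C A ∧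
      ∀ x : ℝ, ∃ C' : ℝ, 0 ≤ C' ∧ ∀ y : ℝ, ∃ g : G, dist (A g x) y ≤ C') ↔
    (∃ H : Subgroup G, (H.index = 1 ∨ H.index = 2) ∧
      ∃ f : H → ℝ, IsPseudocharacter f ∧ f ≠ 0) := by
  constructor
  · rintro ⟨K, C, A, hK, hC, hA, hcb⟩
    obtain ⟨B, hB0, hB⟩ := hcb 0
    exact hA.exists_pseudocharacter hK hC hB0 hB
  · rintro ⟨H, hH | hH, f, hf, hf0⟩
    · have hmem : ∀ g, g ∈ H := by
        rw [Subgroup.index_eq_one] at hH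
        simp [hH]
      obtain ⟨⟨D, hD⟩, hpow⟩ := hf
      obtain ⟨k, hk⟩ := Function.ne_iff.1 hf0
      exact exists_cobounded_quasiAction (fun _ => 1) (fun g => f ⟨g, hmem g⟩) D (by simp)
        (by simp) (fun g h => by simpa using hD ⟨g, hmem g⟩ ⟨h, hmem h⟩) k hk (by simp)
        (fun n => hpow k n)
    · exact exists_cobounded_quasiAction_of_index_two H hH f hf hf0
end
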